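/- arXiv:2105.04926 — 7 statements merged into one kernel-verified Lean document; each statement's English description precedes it below -/
import Mathlib

section
/- Suppose α − k ∉ ℕ₀ (that is, α − k is not a non-negative integer). If u and v are tempered distributions on ℝ^k which both extend 1/q and are both homogeneous of degree −α, then u = v. -/
open MeasureTheory

namespace HomUniq

open SchwartzMap Topology Filter
open scoped ContDiff

/-- Local notation for the Euclidean space. -/
abbrev V (k : ℕ) := EuclideanSpace ℝ (Fin k)

theorem hasFDerivAt_avg {k : ℕ} {F : Type} [NormedAddCommGroup F] [NormedSpace ℝ F]
    [CompleteSpace F] (m : ℕ) (f : V k → F) (hf : ContDiff ℝ 1 f) (x₀ : V k) :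
    HasFDerivAt (fun x => ∫ t in (0:ℝ)..1, t ^ m • f (t • x))
      (∫ t in (0:ℝ)..1, t ^ (m + 1) • fderiv ℝ f (t • x₀)) x₀ := by
  have hf' : Continuous (fderiv ℝ f) := hf.continuous_fderiv (by norm_num)
  have hfc := hf.continuous
  obtain ⟨C, hC⟩ := (isCompact_closedBall (0 : V k) (‖x₀‖ + 1)).exists_bound_of_continuousOn
    hf'.continuousOn
  refine intervalIntegral.hasFDerivAt_integral_of_dominated_of_fderiv_le
    (F := fun x t => t ^ m • f (t • x))
    (F' := fun x t => t ^ (m + 1) • fderiv ℝ f (t • x)) (bound := fun _ => C)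
    (Metric.ball_mem_nhds x₀ one_pos) ?_ ?_ ?_ ?_ ?_ ?_
  · refine Eventually.of_forall fun x => ?_
    exact (by fun_prop : Continuous fun t : ℝ => t ^ m • f (t • x)).aestronglyMeasurable
  · exact (by fun_prop : Continuous fun t : ℝ => t ^ m • f (t • x₀)).intervalIntegrable _ _
  · exact (by fun_prop : Continuous fun t : ℝ =>
      t ^ (m + 1) • fderiv ℝ f (t • x₀)).aestronglyMeasurable
  · refine Eventually.of_forall fun t ht x hx => ?_
    rw [Set.uIoc_of_le zero_le_one] at ht
    have h1 : ‖x‖ ≤ ‖x₀‖ + 1 := by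
      have h2 : ‖x - x₀‖ < 1 := by simpa [dist_eq_norm] using hx
      have h3 := norm_add_le x₀ (x - x₀)
      rw [add_sub_cancel] at h3
      linarith
    have h4 : ‖fderiv ℝ f (t • x)‖ ≤ C := by
      refine hC _ ?_
      rw [mem_closedBall_zero_iff, norm_smul, Real.norm_eq_abs, abs_of_pos ht.1]
      nlinarith [norm_nonneg x, ht.1, ht.2]
    rw [norm_smul, norm_pow, Real.norm_eq_abs, abs_of_pos ht.1]
    calc t ^ (m + 1) * ‖fderiv ℝ f (t • x)‖ ≤ 1 * ‖fderiv ℝ f (t • x)‖ := by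
          gcongr
          exact pow_le_one₀ ht.1.le ht.2
      _ ≤ C := by rw [one_mul]; exact h4
  · exact intervalIntegrable_const
  · refine Eventually.of_forall fun t ht x hx => ?_
    have h1 : HasFDerivAt f (fderiv ℝ f (t • x)) (t • x) :=
      (hf.differentiable (by norm_num) _).hasFDerivAt
    have h2 : HasFDerivAt (fun y : V k => t • y) (t • ContinuousLinearMap.id ℝ (V k)) x :=
      (hasFDerivAt_id x).const_smul t
    have h3 := (h1.comp x h2).const_smul (t ^ m)
    have h4 : t ^ (m + 1) • fderiv ℝ f (t • x) =
        t ^ m • (fderiv ℝ f (t • x)).comp (t • ContinuousLinearMap.id ℝ (V k)) := by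
      refine ContinuousLinearMap.ext fun y => ?_
      simp [pow_succ, mul_smul]
    rw [h4]
    exact h3

theorem contDiff_avg {k : ℕ} (n : ℕ) : ∀ {F : Type} [NormedAddCommGroup F] [NormedSpace ℝ F]
    [CompleteSpace F] (m : ℕ) (f : V k → F), ContDiff ℝ ∞ f →
    ContDiff ℝ n (fun x => ∫ t in (0:ℝ)..1, t ^ m • f (t • x)) := by
  induction n with
  | zero =>
    intro F _ _ _ m f hf
    have h : Differentiable ℝ (fun x => ∫ t in (0:ℝ)..1, t ^ m • f (t • x)) := fun x =>
      (hasFDerivAt_avg m f (hf.of_le (by exact_mod_cast le_top)) x).differentiableAt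
    exact contDiff_zero.2 h.continuous
  | succ n ih =>
    intro F _ _ _ m f hf
    have hd := hasFDerivAt_avg m f (hf.of_le (by exact_mod_cast le_top))
    have := ih (m + 1) (fderiv ℝ f) (hf.fderiv_right (by simp))
    exact_mod_cast contDiff_succ_iff_hasFDerivAt.2 ⟨_, this, hd⟩

theorem hadamard {k : ℕ} (φ : SchwartzMap (V k) ℂ) :
    ∃ g : Fin k → V k → ℂ, (∀ i, ContDiff ℝ ∞ (g i)) ∧
      ∀ x, φ x = φ 0 + ∑ i, (x i : ℂ) * g i x := by
  refine ⟨fun i x => ∫ t in (0:ℝ)..1, fderiv ℝ φ (t • x) (EuclideanSpace.single i 1), ?_, ?_⟩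
  · intro i
    have h1 : ContDiff ℝ ∞ (fun x => fderiv ℝ φ x (EuclideanSpace.single i 1)) :=
      ((φ.smooth ⊤).fderiv_right (by simp)).clm_apply contDiff_const
    refine contDiff_infty.2 fun n => ?_
    simpa using contDiff_avg n 0 _ h1
  · intro x
    have hc : Continuous (fderiv ℝ φ) := (φ.smooth 1).continuous_fderiv (by norm_num)
    have h1 : ∫ t in (0:ℝ)..1, fderiv ℝ φ (t • x) x = φ ((1:ℝ) • x) - φ ((0:ℝ) • x) := by
      refine intervalIntegral.integral_eq_sub_of_hasDerivAt (f := fun t : ℝ => φ (t • x)) ?_ ?_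
      · intro t _
        have h2 : HasDerivAt (fun t : ℝ => t • x) x t := by
          simpa using (hasDerivAt_id t).smul_const x
        exact (φ.differentiable (t • x)).hasFDerivAt.comp_hasDerivAt t h2
      · exact (by fun_prop : Continuous fun t : ℝ => fderiv ℝ φ (t • x) x).intervalIntegrable _ _
    have h3 : ∀ t : ℝ, fderiv ℝ φ (t • x) x =
        ∑ i, (x i : ℂ) * fderiv ℝ φ (t • x) (EuclideanSpace.single i 1) := by
      intro t
      have h4 : x = ∑ i, x i • EuclideanSpace.single i (1:ℝ) := by
        ext j
        simp [Finset.sum_apply, Pi.single_apply]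
      have h5 := congrArg (fderiv ℝ φ (t • x)) h4
      rw [map_sum] at h5
      rw [h5]
      simp
    simp_rw [h3] at h1
    rw [intervalIntegral.integral_finsetSum] at h1
    · simp_rw [intervalIntegral.integral_const_mul] at h1
      rw [h1]; simp
    · intro i _
      exact (by fun_prop : Continuous fun t : ℝ =>
        (x i : ℂ) * fderiv ℝ φ (t • x) (EuclideanSpace.single i 1)).intervalIntegrable _ _

/-- A distribution supported at the origin and homogeneous. -/
structure Good {k : ℕ} (w : SchwartzMap (V k) ℂ →L[ℂ] ℂ) (s : ℝ) : Prop where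
  supp : ∀ φ : SchwartzMap (V k) ℂ, (⇑φ) =ᶠ[𝓝 0] 0 → w φ = 0
  hom : ∀ (φ ψ : SchwartzMap (V k) ℂ) (lam : ℝ), 0 < lam → (∀ x, ψ x = φ (lam • x)) →
    w ψ = ((lam ^ s : ℝ) : ℂ) * w φ

theorem exists_cutoff (k : ℕ) : ∃ χ : V k → ℂ, HasCompactSupport χ ∧ ContDiff ℝ ∞ χ ∧
    χ =ᶠ[𝓝 0] 1 := by
  let b : ContDiffBump (0 : V k) := ⟨1, 2, one_pos, one_lt_two⟩
  refine ⟨fun x => ((b x : ℝ) : ℂ), ?_, ?_, ?_⟩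
  · exact b.hasCompactSupport.comp_left (g := fun r : ℝ => (r : ℂ)) (by simp)
  · exact Complex.ofRealCLM.contDiff.comp b.contDiff
  · filter_upwards [b.eventuallyEq_one] with x hx
    simp [hx]

/-- dilation -/
theorem exists_dil {k : ℕ} (φ : SchwartzMap (V k) ℂ) (lam : ℝ) (h : 0 < lam) :
    ∃ ψ : SchwartzMap (V k) ℂ, ∀ x, ψ x = φ (lam • x) :=
  ⟨compCLMOfContinuousLinearEquiv ℂ
    (ContinuousLinearEquiv.smulLeft (Units.mk0 lam h.ne')) φ, fun x => rfl⟩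

theorem good_neg {k : ℕ} (w : SchwartzMap (V k) ℂ →L[ℂ] ℂ) (s : ℝ) (hs : s < 0)
    (hw : Good w s) : w = 0 := by
  ext φ
  obtain ⟨χ, hχc, hχs, hχ1⟩ := exists_cutoff k
  let X := hχc.toSchwartzMap hχs
  have hX : ∀ x, X x = χ x := fun x => rfl
  have hdil : ∀ n : ℕ, ∃ ψ : SchwartzMap (V k) ℂ, ∀ x, ψ x = φ (((n:ℝ) + 1)⁻¹ • x) :=
    fun n => exists_dil φ _ (by positivity)
  choose ψ hψ using hdil
  have htg : Function.HasTemperateGrowth (X : V k → ℂ) := X.hasTemperateGrowth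
  let f : ℕ → SchwartzMap (V k) ℂ := fun n => smulLeftCLM ℂ (X : V k → ℂ) (ψ n)
  have hf : ∀ n x, f n x = χ x * φ (((n:ℝ) + 1)⁻¹ • x) := fun n x => by
    simp only [f, smulLeftCLM_apply_apply htg, hψ, hX, smul_eq_mul]
  have hfw : ∀ n, w (f n) = (((((n:ℝ) + 1)⁻¹) ^ s : ℝ) : ℂ) * w φ := by
    intro n
    rw [← hw.hom φ (ψ n) _ (by positivity) (hψ n), ← sub_eq_zero, ← map_sub]
    refine hw.supp _ ?_
    filter_upwards [hχ1] with x hx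
    simp [hf, hψ, hx]
  have hbdd : Bornology.IsVonNBounded ℂ (Set.range f) := by
    rw [(schwartz_withSeminorms ℂ (V k) ℂ).isVonNBounded_iff_seminorm_bddAbove]
    rintro ⟨K, N⟩
    refine ⟨∑ i ∈ Finset.range (N + 1), (N.choose i : ℝ) * SchwartzMap.seminorm ℂ K i X *
      SchwartzMap.seminorm ℂ 0 (N - i) φ, ?_⟩
    rintro _ ⟨_, ⟨n, rfl⟩, rfl⟩
    rw [schwartzSeminormFamily_apply]
    refine seminorm_le_bound ℂ K N (f n) (by positivity) fun x => ?_
    have hfe : (f n : V k → ℂ) = fun x => X x * ψ n x := by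
      ext x; rw [hf, hψ, hX]
    rw [hfe]
    have h1 := norm_iteratedFDeriv_mul_le (𝕜 := ℝ) (X.smooth ⊤) ((ψ n).smooth ⊤) x
      (n := N) (by exact_mod_cast le_top)
    refine (mul_le_mul_of_nonneg_left h1 (by positivity)).trans ?_
    rw [Finset.mul_sum]
    refine Finset.sum_le_sum fun i _ => ?_
    have h2 := le_seminorm ℂ K i X x
    have h3 : ‖iteratedFDeriv ℝ (N - i) (ψ n) x‖ ≤ SchwartzMap.seminorm ℂ 0 (N - i) φ := by
      have h4 : (ψ n : V k → ℂ) = fun x => φ (((n:ℝ) + 1)⁻¹ • x) := funext (hψ n)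
      rw [h4, iteratedFDeriv_comp_const_smul _ (φ.smooth _)]
      rw [norm_smul, norm_pow]
      refine le_trans ?_ (norm_iteratedFDeriv_le_seminorm ℂ φ (N - i) (((n:ℝ) + 1)⁻¹ • x))
      refine mul_le_of_le_one_left (norm_nonneg _) (pow_le_one₀ (norm_nonneg _) ?_)
      rw [Real.norm_eq_abs, abs_of_pos (by positivity)]
      exact inv_le_one_of_one_le₀ (by simp)
    calc _ = (N.choose i : ℝ) * (‖x‖ ^ K * ‖iteratedFDeriv ℝ i X x‖) *
        ‖iteratedFDeriv ℝ (N - i) (ψ n) x‖ := by ring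
      _ ≤ _ := by gcongr
  have hb2 := hbdd.image w
  rw [NormedSpace.isVonNBounded_iff, isBounded_iff_forall_norm_le] at hb2
  obtain ⟨C, hC⟩ := hb2
  by_contra hne
  have hpos : 0 < ‖w φ‖ := norm_pos_iff.2 hne
  have hlim : Tendsto (fun n : ℕ => ((n:ℝ) + 1) ^ (-s) * ‖w φ‖) atTop atTop :=
    ((tendsto_rpow_atTop (neg_pos.2 hs)).comp
      (tendsto_atTop_add_const_right _ 1 tendsto_natCast_atTop_atTop)).atTop_mul_const hpos
  obtain ⟨n, hn⟩ := (hlim.eventually_gt_atTop C).exists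
  have h5 := hC (w (f n)) ⟨_, ⟨n, rfl⟩, rfl⟩
  rw [hfw, norm_mul, Complex.norm_real, Real.norm_eq_abs, abs_of_pos (by positivity),
    Real.inv_rpow (by positivity), ← Real.rpow_neg (by positivity)] at h5
  linarith

theorem coord_growth {k : ℕ} (i : Fin k) :
    Function.HasTemperateGrowth (fun x : V k => (x i : ℂ)) :=
  (Complex.ofRealCLM.comp (EuclideanSpace.proj (𝕜 := ℝ) i)).hasTemperateGrowth

theorem good_mul {k : ℕ} (w : SchwartzMap (V k) ℂ →L[ℂ] ℂ) (s : ℝ)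
    (hw : Good w s) (i : Fin k) :
    Good (w.comp (smulLeftCLM ℂ (fun x : V k => (x i : ℂ)))) (s - 1) := by
  have hg := coord_growth (k := k) i
  constructor
  · intro φ hφ
    refine hw.supp _ ?_
    filter_upwards [hφ] with x hx
    simp [smulLeftCLM_apply_apply hg, hx]
  · intro φ ψ lam hl h
    have h1 := hw.hom (smulLeftCLM ℂ (fun x : V k => (x i : ℂ)) φ)
      ((lam : ℂ) • smulLeftCLM ℂ (fun x : V k => (x i : ℂ)) ψ) lam hl (by
        intro x
        simp [smulLeftCLM_apply_apply hg, h, mul_assoc])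
    rw [map_smul, smul_eq_mul] at h1
    have hl' : (lam : ℂ) ≠ 0 := by exact_mod_cast hl.ne'
    simp only [ContinuousLinearMap.comp_apply]
    rw [Real.rpow_sub_one hl.ne']
    push_cast
    field_simp
    rw [mul_comm, h1]

theorem good_step {k : ℕ} (w : SchwartzMap (V k) ℂ →L[ℂ] ℂ) (s : ℝ) (hs : s ≠ 0)
    (hw : Good w s)
    (h0 : ∀ i, w.comp (smulLeftCLM ℂ (fun x : V k => (x i : ℂ))) = 0) : w = 0 := by
  obtain ⟨χ, hχc, hχs, hχ1⟩ := exists_cutoff k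
  let X := hχc.toSchwartzMap hχs
  have hX : ∀ x, X x = χ x := fun x => rfl
  have hX0 : X 0 = 1 := by rw [hX]; exact hχ1.eq_of_nhds
  have key : ∀ φ : SchwartzMap (V k) ℂ, w φ = φ 0 * w X := by
    intro φ
    obtain ⟨g, hg, hgx⟩ := hadamard φ
    have hc : ∀ i, HasCompactSupport (fun x => χ x * g i x) := fun i => hχc.mul_right
    let G : Fin k → SchwartzMap (V k) ℂ := fun i => (hc i).toSchwartzMap (hχs.mul (hg i))
    have hG : ∀ i x, G i x = χ x * g i x := fun i x => rfl
    have h1 : w (φ - (φ 0 • X + ∑ i, smulLeftCLM ℂ (fun x : V k => (x i : ℂ)) (G i))) = 0 := by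
      refine hw.supp _ ?_
      filter_upwards [hχ1] with x hx
      have := hgx x
      simp [smulLeftCLM_apply_apply (coord_growth _), hG, hX, hx, ← this]
    have h2 : ∀ i, w (smulLeftCLM ℂ (fun x : V k => (x i : ℂ)) (G i)) = 0 := fun i =>
      congrArg (fun L : SchwartzMap (V k) ℂ →L[ℂ] ℂ => L (G i)) (h0 i)
    rw [map_sub, map_add, map_sum, map_smul, Finset.sum_eq_zero (fun i _ => h2 i), add_zero,
      sub_eq_zero] at h1
    exact h1
  have hwX : w X = 0 := by
    obtain ⟨ψ, hψ⟩ := exists_dil X 2 two_pos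
    have h1 := hw.hom X ψ 2 two_pos hψ
    rw [key ψ, hψ, smul_zero, hX0, one_mul] at h1
    have h2 : ((2:ℝ) ^ s) ≠ 1 := by
      rcases lt_or_gt_of_ne hs with h | h
      · exact (Real.rpow_lt_one_of_one_lt_of_neg one_lt_two h).ne
      · exact (Real.one_lt_rpow one_lt_two h).ne'
    have h3 : (1 - (((2:ℝ) ^ s : ℝ) : ℂ)) * w X = 0 := by rw [sub_mul, one_mul, ← h1, sub_self]
    rcases mul_eq_zero.1 h3 with h | h
    · exact absurd (by exact_mod_cast (sub_eq_zero.1 h).symm) h2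
    · exact h
  ext φ
  rw [key, hwX, mul_zero]; rfl

theorem good_zero {k : ℕ} (n : ℕ) : ∀ (w : SchwartzMap (V k) ℂ →L[ℂ] ℂ) (s : ℝ), s < n →
    (∀ m : ℕ, s ≠ m) → Good w s → w = 0 := by
  induction n with
  | zero => intro w s hs _ hw; exact good_neg w s (by simpa using hs) hw
  | succ n ih =>
    intro w s hs hm hw
    refine good_step w s (by simpa using hm 0) hw fun i => ?_
    refine ih _ (s - 1) (by push_cast at hs; linarith) ?_ (good_mul w s hw i)
    intro m h
    exact hm (m + 1) (by push_cast; linarith)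

end HomUniq



/-- If `α - k` is not a non-negative integer, a tempered distribution extending
`1/q` and homogeneous of degree `-α` is unique. -/
theorem statement2 (k : ℕ) (hk : 1 ≤ k) (α : ℝ) (hα : 0 < α)
    (hnot : ∀ m : ℕ, α - k ≠ m)
    (q : EuclideanSpace ℝ (Fin k) → ℂ) (hq_cont : Continuous q)
    (hq_ell : ∀ η, q η = 0 → η = 0)
    (hq_hom : ∀ lam : ℝ, 0 < lam → ∀ η : EuclideanSpace ℝ (Fin k), η ≠ 0 →
      q (lam • η) = ((lam ^ α : ℝ) : ℂ) * q η)
    (u v : SchwartzMap (EuclideanSpace ℝ (Fin k)) ℂ →L[ℂ] ℂ)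
    (hu_ext : ∀ φ : SchwartzMap (EuclideanSpace ℝ (Fin k)) ℂ,
      tsupport (⇑φ) ⊆ {η | η ≠ 0} → u φ = ∫ η, φ η / q η)
    (hv_ext : ∀ φ : SchwartzMap (EuclideanSpace ℝ (Fin k)) ℂ,
      tsupport (⇑φ) ⊆ {η | η ≠ 0} → v φ = ∫ η, φ η / q η)
    (hu_hom : ∀ (φ ψ : SchwartzMap (EuclideanSpace ℝ (Fin k)) ℂ) (lam : ℝ), 0 < lam →
      (∀ η, ψ η = (lam : ℂ) ^ k * φ (lam • η)) →
      u φ = ((lam ^ (-α) : ℝ) : ℂ) * u ψ)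
    (hv_hom : ∀ (φ ψ : SchwartzMap (EuclideanSpace ℝ (Fin k)) ℂ) (lam : ℝ), 0 < lam →
      (∀ η, ψ η = (lam : ℂ) ^ k * φ (lam • η)) →
      v φ = ((lam ^ (-α) : ℝ) : ℂ) * v ψ) :
    u = v := by
  obtain ⟨n, hn⟩ := exists_nat_gt (α - k)
  refine sub_eq_zero.1 (HomUniq.good_zero n (u - v) (α - k) hn hnot ⟨?_, ?_⟩)
  · intro φ hφ
    have h : tsupport (⇑φ) ⊆ {η | η ≠ 0} := by
      rintro x hx rfl
      exact notMem_tsupport_iff_eventuallyEq.2 hφ hx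
    rw [sub_apply, hu_ext φ h, hv_ext φ h, sub_self]
  · intro φ ψ lam hl h
    have h1 : ∀ η, (((lam : ℂ) ^ k) • ψ) η = (lam : ℂ) ^ k * φ (lam • η) := by
      intro η
      simp [h]
    have h2 := hu_hom φ _ lam hl h1
    have h3 := hv_hom φ _ lam hl h1
    have hl' : (lam : ℂ) ^ k ≠ 0 := pow_ne_zero _ (by exact_mod_cast hl.ne')
    have hla : ((lam ^ α : ℝ) : ℂ) ≠ 0 := by exact_mod_cast (Real.rpow_pos_of_pos hl α).ne'
    rw [sub_apply, sub_apply, h2, h3, map_smul, map_smul,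
      Real.rpow_neg hl.le, Real.rpow_sub hl, Real.rpow_natCast, smul_eq_mul, smul_eq_mul]
    push_cast
    field_simp
end

section
/- Suppose m := α − k ∈ ℕ₀. If there exists a tempered distribution u on ℝ^k which extends 1/q and is homogeneous of degree −α, then q satisfies the cancellation condition (c). -/
open MeasureTheory

lemma polar_aux {k : ℕ} (f : EuclideanSpace ℝ (Fin k) → ℂ)
    (hk : 1 ≤ k)
    (A : Metric.sphere (0 : EuclideanSpace ℝ (Fin k)) 1 → ℂ) (F : ℝ → ℂ)
    (h : ∀ (θ : Metric.sphere (0 : EuclideanSpace ℝ (Fin k)) 1) (r : ℝ), 0 < r →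
      f (r • (θ : EuclideanSpace ℝ (Fin k))) = A θ * F r) :
    ∫ x, f x = (∫ θ, A θ ∂((volume : Measure (EuclideanSpace ℝ (Fin k))).toSphere)) *
      ∫ r : Set.Ioi (0 : ℝ), F r ∂(Measure.volumeIoiPow (k - 1)) := by
  have : Nonempty (Fin k) := ⟨⟨0, hk⟩⟩
  let μ := (volume : Measure (EuclideanSpace ℝ (Fin k)))
  have hd : Module.finrank ℝ (EuclideanSpace ℝ (Fin k)) = k := by simp
  calc
    ∫ x, f x = ∫ x : ({(0)}ᶜ : Set (EuclideanSpace ℝ (Fin k))), f x.1 ∂(μ.comap (↑)) := by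
      rw [integral_subtype_comap (measurableSet_singleton _).compl f,
        restrict_compl_singleton]
    _ = ∫ x, A x.1 * F x.2 ∂μ.toSphere.prod (.volumeIoiPow (k - 1)) := by
      have h2 := μ.measurePreserving_homeomorphUnitSphereProd.integral_comp
        (Homeomorph.measurableEmbedding _) (fun x => A x.1 * F x.2)
      rw [hd] at h2
      rw [← h2]
      congr 1
      ext x
      set y := homeomorphUnitSphereProd (EuclideanSpace ℝ (Fin k)) x with hy
      have : x = (homeomorphUnitSphereProd (EuclideanSpace ℝ (Fin k))).symm y := by simp [hy]
      rw [← h y.1 y.2 y.2.2, this]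
      rfl
    _ = _ := integral_prod_mul A (fun r : Set.Ioi (0:ℝ) => F r)

lemma schwartz_aux {k : ℕ} (β : Fin k → ℕ) (c : ℝ) (hc : 1 ≤ c) :
    ∃ w : SchwartzMap (EuclideanSpace ℝ (Fin k)) ℂ, ∀ η, w η =
      (∏ i, ((η i : ℝ) : ℂ) ^ β i) * ((Real.smoothTransition (2 - c * ‖η‖ ^ 2) : ℝ) : ℂ) := by
  have h2 : ContDiff ℝ (⊤ : ℕ∞) (fun η : EuclideanSpace ℝ (Fin k) =>
      (∏ i, ((η i : ℝ) : ℂ) ^ β i) *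
        ((Real.smoothTransition (2 - c * ‖η‖ ^ 2) : ℝ) : ℂ)) := by
    apply ContDiff.mul
    · apply contDiff_prod
      intro i _
      apply ContDiff.pow
      exact Complex.ofRealCLM.contDiff.comp (EuclideanSpace.proj (𝕜 := ℝ) i).contDiff
    · apply Complex.ofRealCLM.contDiff.comp
      apply Real.smoothTransition.contDiff.comp
      exact contDiff_const.sub (contDiff_const.mul (contDiff_norm_sq ℝ))
  have h1 : HasCompactSupport (fun η : EuclideanSpace ℝ (Fin k) =>
      (∏ i, ((η i : ℝ) : ℂ) ^ β i) *
        ((Real.smoothTransition (2 - c * ‖η‖ ^ 2) : ℝ) : ℂ)) := by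
    apply HasCompactSupport.intro (isCompact_closedBall (0 : EuclideanSpace ℝ (Fin k)) 2)
    intro x hx
    have hx : 2 < ‖x‖ := by simpa using hx
    rw [Real.smoothTransition.zero_of_nonpos (by nlinarith)]
    simp
  exact ⟨h1.toSchwartzMap h2, fun η => rfl⟩

/-- radial cutoff difference -/
noncomputable def gAux (r : ℝ) : ℝ :=
  Real.smoothTransition (2 - 1 * r ^ 2) - Real.smoothTransition (2 - 4 * r ^ 2)

lemma gAux_nonneg (r : ℝ) : 0 ≤ gAux r :=
  sub_nonneg.2 (Real.smoothTransition.monotone (by nlinarith [sq_nonneg r]))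

lemma gAux_zero_small (r : ℝ) (h0 : 0 ≤ r) (h : r ≤ 1 / 2) : gAux r = 0 := by
  unfold gAux
  rw [Real.smoothTransition.one_of_one_le (by nlinarith),
    Real.smoothTransition.one_of_one_le (by nlinarith), sub_self]

lemma gAux_zero_large (r : ℝ) (h : 2 < r) : gAux r = 0 := by
  unfold gAux
  rw [Real.smoothTransition.zero_of_nonpos (by nlinarith),
    Real.smoothTransition.zero_of_nonpos (by nlinarith), sub_self]

lemma gAux_one : gAux 1 = 1 := by
  unfold gAux
  rw [Real.smoothTransition.one_of_one_le (by norm_num),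
    Real.smoothTransition.zero_of_nonpos (by norm_num), sub_zero]

lemma gAux_cont : Continuous gAux := by
  unfold gAux
  have := Real.smoothTransition.continuous
  fun_prop

lemma radial_aux {k : ℕ} (hk : 1 ≤ k) :
    ∫ r : Set.Ioi (0 : ℝ), ((gAux (r : ℝ) / (max (r : ℝ) (1/2)) ^ k : ℝ) : ℂ)
      ∂(Measure.volumeIoiPow (k - 1)) ≠ 0 := by
  have : Nonempty (Fin k) := ⟨⟨0, hk⟩⟩
  have hp := polar_aux (fun x : EuclideanSpace ℝ (Fin k) =>
    ((gAux ‖x‖ / (max ‖x‖ (1/2)) ^ k : ℝ) : ℂ)) hk (fun _ => 1)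
    (fun r => ((gAux r / (max r (1/2)) ^ k : ℝ) : ℂ)) (by
      intro θ r hr
      have : ‖(θ : EuclideanSpace ℝ (Fin k))‖ = 1 := by simp
      simp [norm_smul, this, abs_of_pos hr])
  have hpos : 0 < ∫ x : EuclideanSpace ℝ (Fin k), gAux ‖x‖ / (max ‖x‖ (1/2)) ^ k := by
    apply Continuous.integral_pos_of_hasCompactSupport_nonneg_nonzero
      (x := EuclideanSpace.single ⟨0, hk⟩ (1:ℝ))
    · apply Continuous.div
      · exact gAux_cont.comp continuous_norm
      · fun_prop
      · intro x
        positivity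
    · apply HasCompactSupport.intro (isCompact_closedBall (0 : EuclideanSpace ℝ (Fin k)) 2)
      intro x hx
      have hx : 2 < ‖x‖ := by simpa using hx
      rw [gAux_zero_large _ hx, zero_div]
    · intro x
      exact div_nonneg (gAux_nonneg _) (by positivity)
    · simp only [EuclideanSpace.norm_single, norm_one, gAux_one]
      positivity
  intro h0
  rw [h0, mul_zero, integral_complex_ofReal] at hp
  exact hpos.ne' (by exact_mod_cast hp)

/-- For `m = α - k ∈ ℕ₀`, if some tempered distribution extends `1/q` and is
homogeneous of degree `-α`, then `q` satisfies the cancellation condition. -/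
theorem statement5 (k : ℕ) (hk : 1 ≤ k) (α : ℝ) (hα : 0 < α) (m : ℕ) (hm : α - k = m)
    (q : EuclideanSpace ℝ (Fin k) → ℂ) (hq_cont : Continuous q)
    (hq_ell : ∀ η, q η = 0 → η = 0)
    (hq_hom : ∀ lam : ℝ, 0 < lam → ∀ η : EuclideanSpace ℝ (Fin k), η ≠ 0 →
      q (lam • η) = ((lam ^ α : ℝ) : ℂ) * q η)
    (u : SchwartzMap (EuclideanSpace ℝ (Fin k)) ℂ →L[ℂ] ℂ)
    (hu_ext : ∀ φ : SchwartzMap (EuclideanSpace ℝ (Fin k)) ℂ,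
      tsupport (⇑φ) ⊆ {η | η ≠ 0} → u φ = ∫ η, φ η / q η)
    (hu_hom : ∀ (φ ψ : SchwartzMap (EuclideanSpace ℝ (Fin k)) ℂ) (lam : ℝ), 0 < lam →
      (∀ η, ψ η = (lam : ℂ) ^ k * φ (lam • η)) →
      u φ = ((lam ^ (-α) : ℝ) : ℂ) * u ψ) :
    ∀ β : Fin k → ℕ, (∑ i, β i) = m →
      (∫ θ : Metric.sphere (0 : EuclideanSpace ℝ (Fin k)) 1,
          (∏ i, (((θ : EuclideanSpace ℝ (Fin k)) i : ℝ) : ℂ) ^ β i) /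
            q (θ : EuclideanSpace ℝ (Fin k))
        ∂((volume : Measure (EuclideanSpace ℝ (Fin k))).toSphere)) = 0 := by
  intro β hβ
  obtain ⟨φ, hφ⟩ := schwartz_aux β 1 le_rfl
  obtain ⟨ψ, hψ⟩ := schwartz_aux β 4 (by norm_num)
  have hαk : α = ((m + k : ℕ) : ℝ) := by push_cast; linarith
  have h2α : (((2:ℝ) ^ α : ℝ) : ℂ) = 2 ^ m * 2 ^ k := by
    rw [hαk, Real.rpow_natCast]; push_cast; rw [pow_add]
  have hmono : ∀ (r : ℝ) (η : EuclideanSpace ℝ (Fin k)),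
      (∏ i, (((r • η) i : ℝ) : ℂ) ^ β i) = (r : ℂ) ^ m * ∏ i, ((η i : ℝ) : ℂ) ^ β i := by
    intro r η
    simp only [PiLp.smul_apply, smul_eq_mul, Complex.ofReal_mul, mul_pow,
      Finset.prod_mul_distrib, Finset.prod_pow_eq_pow_sum, hβ]
  have hu := hu_hom φ ((((2:ℝ) ^ α : ℝ) : ℂ) • ψ) 2 (by norm_num) (by
    intro η
    rw [SchwartzMap.smul_apply, hφ, hψ, hmono, norm_smul, h2α, mul_pow]
    norm_num
    ring)
  have hu0 : u (φ - ψ) = 0 := by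
    rw [map_sub, hu, map_smul, smul_eq_mul, ← mul_assoc, ← Complex.ofReal_mul,
      ← Real.rpow_add (by norm_num)]
    simp
  have hD : ∀ η, (φ - ψ) η = (∏ i, ((η i : ℝ) : ℂ) ^ β i) * (gAux ‖η‖ : ℂ) := by
    intro η
    rw [SchwartzMap.sub_apply, hφ, hψ, gAux]
    push_cast
    ring
  rw [hu_ext (φ - ψ) (by
    have : tsupport (⇑(φ - ψ)) ⊆ {η | 1 / 2 ≤ ‖η‖} := by
      apply closure_minimal
      · intro η hη
        by_contra hlt
        simp only [Set.mem_ofPred_eq, not_le] at hlt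
        apply hη
        rw [hD, gAux_zero_small _ (norm_nonneg _) hlt.le]
        simp
      · exact isClosed_le continuous_const continuous_norm
    intro η hη h0
    have := this hη
    rw [h0] at this
    norm_num at this)] at hu0
  rw [polar_aux _ hk (fun θ => (∏ i, (((θ : EuclideanSpace ℝ (Fin k)) i : ℝ) : ℂ) ^ β i) /
            q (θ : EuclideanSpace ℝ (Fin k)))
    (fun r => ((gAux r / (max r (1/2)) ^ k : ℝ) : ℂ)) (by
      intro θ r hr
      have hθ : ‖(θ : EuclideanSpace ℝ (Fin k))‖ = 1 := by simp
      have hθ0 : (θ : EuclideanSpace ℝ (Fin k)) ≠ 0 := by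
        intro h; rw [h] at hθ; simp at hθ
      have hq0 : q θ ≠ 0 := fun h => hθ0 (hq_ell _ h)
      have hr0 : (r : ℂ) ≠ 0 := by exact_mod_cast hr.ne'
      rw [hD, hmono, hq_hom r hr _ hθ0, norm_smul, hθ, mul_one, Real.norm_of_nonneg hr.le,
        hαk, Real.rpow_natCast]
      rcases le_total r (1/2) with h | h
      · rw [gAux_zero_small _ hr.le h]; simp
      · rw [max_eq_left h]
        push_cast
        rw [pow_add]
        field_simp)] at hu0
  exact (mul_eq_zero.1 hu0).resolve_right (radial_aux hk)
end

section
/- Let n ≥ 2, 1 ≤ k ≤ n − 1 and 0 < α < k/2, and let q : ℝ^k → ℂ be as in the standing assumptions. Then the function θ ↦ |q(θ·e₁, …, θ·e_k)|^{−2}, defined for those θ ∈ S^{n−1} with (θ·e₁, …, θ·e_k) ≠ 0, is integrable on S^{n−1} with respect to the surface measure dS: ∫_{S^{n−1}} |q(θ·e₁, …, θ·e_k)|^{−2} dS(θ) < ∞. -/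
open MeasureTheory

/-- The projection `ℝⁿ → ℝ^k`, `ξ ↦ (ξ·e₁, …, ξ·e_k)`, onto the first `k` coordinates. -/
noncomputable def projK (n k : ℕ) (hkn : k ≤ n) (ξ : EuclideanSpace ℝ (Fin n)) :
    EuclideanSpace ℝ (Fin k) :=
  (EuclideanSpace.equiv (Fin k) ℝ).symm fun i => ξ (Fin.castLE hkn i)

lemma q_lower {k : ℕ} (hk : 1 ≤ k) (α : ℝ)
    (q : EuclideanSpace ℝ (Fin k) → ℂ) (hq_cont : Continuous q)
    (hq_ell : ∀ η, q η = 0 → η = 0)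
    (hq_hom : ∀ lam : ℝ, 0 < lam → ∀ η : EuclideanSpace ℝ (Fin k), η ≠ 0 →
      q (lam • η) = ((lam ^ α : ℝ) : ℂ) * q η) :
    ∃ c : ℝ, 0 < c ∧ ∀ η, η ≠ 0 → c * ‖η‖ ^ α ≤ ‖q η‖ := by
  haveI : Nonempty (Fin k) := ⟨⟨0, hk⟩⟩
  have hne : (Metric.sphere (0 : EuclideanSpace ℝ (Fin k)) 1).Nonempty :=
    NormedSpace.sphere_nonempty.2 zero_le_one
  obtain ⟨u, hu, hmin⟩ := (isCompact_sphere (0 : EuclideanSpace ℝ (Fin k)) 1).exists_isMinOn hne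
    (hq_cont.norm.continuousOn)
  have hu0 : u ≠ 0 := by
    rintro rfl
    simp at hu
  refine ⟨‖q u‖, norm_pos_iff.2 fun h => hu0 (hq_ell u h), fun η hη => ?_⟩
  have hη' : 0 < ‖η‖ := norm_pos_iff.2 hη
  have hm : ‖η‖⁻¹ • η ∈ Metric.sphere (0 : EuclideanSpace ℝ (Fin k)) 1 := by
    simp [norm_smul, hη]
  have h1 := hq_hom ‖η‖ hη' (‖η‖⁻¹ • η) (by simp [hη])
  rw [smul_inv_smul₀ hη'.ne'] at h1
  have h2 : ‖q u‖ ≤ ‖q (‖η‖⁻¹ • η)‖ := hmin hm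
  rw [h1, norm_mul, Complex.norm_real, Real.norm_of_nonneg (by positivity), mul_comm]
  gcongr

lemma q_ball {k : ℕ} (hk : 1 ≤ k) (α : ℝ) (hα : 0 < α) (hαk : α < k / 2)
    (q : EuclideanSpace ℝ (Fin k) → ℂ) (hq_cont : Continuous q)
    (hq_ell : ∀ η, q η = 0 → η = 0)
    (hq_hom : ∀ lam : ℝ, 0 < lam → ∀ η : EuclideanSpace ℝ (Fin k), η ≠ 0 →
      q (lam • η) = ((lam ^ α : ℝ) : ℂ) * q η) :
    ∫⁻ η in Metric.ball (0 : EuclideanSpace ℝ (Fin k)) 1,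
      ENNReal.ofReal ((‖q η‖ ^ 2)⁻¹) < ⊤ := by
  haveI : Nonempty (Fin k) := ⟨⟨0, hk⟩⟩
  obtain ⟨c, hc, hle⟩ := q_lower hk α q hq_cont hq_ell hq_hom
  have hint : IntegrableOn (fun x : EuclideanSpace ℝ (Fin k) => (c ^ 2)⁻¹ * ‖x‖ ^ (-(2 * α)))
      (Metric.ball 0 1) := by
    refine Integrable.const_mul ?_ _
    refine (integrableOn_fun_norm_addHaar (volume : Measure (EuclideanSpace ℝ (Fin k)))
      (f := fun y => y ^ (-(2 * α)))).2 ?_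
    have h := (intervalIntegral.integrableOn_Ioo_rpow_iff (s := (k - 1 : ℝ) - 2 * α)
      (zero_lt_one' ℝ)).2 (by linarith)
    refine h.congr_fun (fun y hy => ?_) measurableSet_Ioo
    simp only [finrank_euclideanSpace, Fintype.card_fin, smul_eq_mul]
    rw [sub_eq_add_neg, Real.rpow_add hy.1, ← Real.rpow_natCast, Nat.cast_sub hk, Nat.cast_one]
  refine lt_of_le_of_lt (lintegral_mono_ae ?_) hint.lintegral_lt_top
  filter_upwards [ae_restrict_of_ae (Measure.ae_ne volume (0 : EuclideanSpace ℝ (Fin k)))] with x hx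
  apply ENNReal.ofReal_le_ofReal
  have hx' : 0 < ‖x‖ := norm_pos_iff.2 hx
  have e : (c ^ 2)⁻¹ * ‖x‖ ^ (-(2 * α)) = ((c * ‖x‖ ^ α) ^ 2)⁻¹ := by
    rw [Real.rpow_neg hx'.le, mul_pow, mul_inv, ← Real.rpow_mul_natCast hx'.le]
    norm_num [mul_comm]
  rw [e]
  have := hle x hx
  gcongr

lemma proj_ball (k m : ℕ) (f : EuclideanSpace ℝ (Fin k) → ENNReal) (hf : Measurable f)
    (hfin : ∫⁻ η in Metric.ball 0 1, f η < ⊤) :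
    ∫⁻ x in Metric.ball (0 : EuclideanSpace ℝ (Fin (k + m))) 1,
      f (projK (k + m) k (by omega) x) < ⊤ := by
  let e1 := (MeasurableEquiv.piCongrLeft (fun _ : Fin (k + m) => ℝ) finSumFinEquiv).symm
  have he1 : MeasurePreserving e1 volume volume :=
    (volume_measurePreserving_piCongrLeft (fun _ : Fin (k + m) => ℝ) finSumFinEquiv).symm
  let e2 := MeasurableEquiv.sumPiEquivProdPi (fun _ : Fin k ⊕ Fin m => ℝ)
  have he2 : MeasurePreserving e2 volume volume :=
    volume_measurePreserving_sumPiEquivProdPi _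
  have h3 := (PiLp.volume_preserving_toLp (Fin k)).prod (PiLp.volume_preserving_toLp (Fin m))
  have h := h3.comp (he2.comp (he1.comp (PiLp.volume_preserving_ofLp (Fin (k+m)))))
  set g := (Prod.map (@WithLp.toLp 2 (Fin k → ℝ)) (@WithLp.toLp 2 (Fin m → ℝ)) ∘ e2 ∘ e1 ∘
    (@WithLp.ofLp 2 (Fin (k+m) → ℝ))) with hg
  have hg1 : ∀ x, (g x).1 = projK (k + m) k (by omega) x := by
    intro x; ext i
    rfl
  have hg2 : ∀ x i, (g x).2 i = x (Fin.natAdd k i) := by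
    intro x i
    rfl
  have hn : ∀ x, ‖x‖ ^ 2 = ‖(g x).1‖ ^ 2 + ‖(g x).2‖ ^ 2 := by
    intro x
    simp only [EuclideanSpace.norm_sq_eq, Fin.sum_univ_add, hg2]
    rfl
  let S := Metric.ball (0 : EuclideanSpace ℝ (Fin k)) 1 ×ˢ Metric.ball (0 : EuclideanSpace ℝ (Fin m)) 1
  have hS : MeasurableSet S := measurableSet_ball.prod measurableSet_ball
  have hsub : Metric.ball (0 : EuclideanSpace ℝ (Fin (k + m))) 1 ⊆ g ⁻¹' S := by
    intro x hx
    have hx : ‖x‖ < 1 := by simpa using hx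
    have := hn x
    simp only [S, Set.mem_preimage, Set.mem_prod, mem_ball_zero_iff]
    constructor <;> nlinarith [norm_nonneg x, norm_nonneg (g x).1, norm_nonneg (g x).2]
  refine lt_of_le_of_lt (lintegral_mono_set hsub) ?_
  simp only [← hg1]
  rw [h.setLIntegral_comp_preimage hS (f := fun p => f p.1) (by fun_prop), ← Measure.prod_restrict]
  have := lintegral_prod_mul (μ := volume.restrict (Metric.ball (0 : EuclideanSpace ℝ (Fin k)) 1))
    (ν := volume.restrict (Metric.ball (0 : EuclideanSpace ℝ (Fin m)) 1)) (f := f)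
    (g := fun _ => 1) hf.aemeasurable aemeasurable_const
  simp only [mul_one] at this
  rw [this]
  refine ENNReal.mul_lt_top hfin ?_
  simpa using measure_ball_lt_top

lemma sphere_le {E : Type*} [NormedAddCommGroup E] [NormedSpace ℝ E] [MeasurableSpace E]
    [BorelSpace E] (μ : Measure E) (f : E → ENNReal) (hf : Measurable f)
    (hmono : ∀ x, ∀ r : ℝ, 0 < r → r < 1 → f x ≤ f (r • x)) :
    ∫⁻ θ, f (θ : E) ∂μ.toSphere ≤ Module.finrank ℝ E * ∫⁻ x in Metric.ball 0 1, f x ∂μ := by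
  have hemb : MeasurableEmbedding (Subtype.val ∘ (homeomorphUnitSphereProd E).symm) :=
    (MeasurableEmbedding.subtype_coe (measurableSet_singleton (0 : E)).compl).comp
      (Homeomorph.measurableEmbedding _)
  have hval : ∀ p, (Subtype.val ∘ (homeomorphUnitSphereProd E).symm) p = (p.2 : ℝ) • (p.1 : E) :=
    fun p => by simp
  have hf' : Measurable fun θ : Metric.sphere (0 : E) 1 => f θ := hf.comp measurable_subtype_coe
  rw [Measure.toSphere, lintegral_smul_measure, Measure.fst, lintegral_map hf' measurable_fst,
    nsmul_eq_mul]
  gcongr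
  set φ := (Subtype.val ∘ (homeomorphUnitSphereProd E).symm) with hφ
  have hT : MeasurableSet ((Set.univ : Set (Metric.sphere (0 : E) 1)) ×ˢ
    Set.Iio (⟨1, Set.mem_Ioi.2 one_pos⟩ : Set.Ioi (0:ℝ))) := MeasurableSet.univ.prod measurableSet_Iio
  set T := ((Set.univ : Set (Metric.sphere (0 : E) 1)) ×ˢ
    Set.Iio (⟨1, Set.mem_Ioi.2 one_pos⟩ : Set.Ioi (0:ℝ))) with hTd
  have hlt : ∀ p ∈ T, (p.2 : ℝ) < 1 := fun p hp => hp.2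
  calc ∫⁻ p in T, f (p.1 : E) ∂(μ.comap φ) ≤ ∫⁻ p in T, f (φ p) ∂(μ.comap φ) := by
        refine setLIntegral_mono' hT fun p hp => ?_
        rw [hval]
        exact hmono _ _ p.2.2 (hlt p hp)
    _ ≤ ∫⁻ p in φ ⁻¹' (Metric.ball 0 1), f (φ p) ∂(μ.comap φ) := by
        refine lintegral_mono_set fun p hp => ?_
        have h0 : (0:ℝ) < p.2 := p.2.2
        simp only [Set.mem_preimage, hval, mem_ball_zero_iff, norm_smul, norm_eq_of_mem_sphere,
          mul_one, Real.norm_of_nonneg h0.le]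
        exact hlt p hp
    _ = ∫⁻ x in Metric.ball 0 1, f x ∂((μ.comap φ).map φ) := by
        rw [hemb.restrict_map, hemb.lintegral_map]
    _ ≤ ∫⁻ x in Metric.ball 0 1, f x ∂μ := by
        rw [hemb.map_comap]
        exact lintegral_mono' (Measure.restrict_mono le_rfl Measure.restrict_le_self) le_rfl

/-- For `n ≥ 2`, `1 ≤ k ≤ n-1` and `0 < α < k/2`, the function
`θ ↦ |q(θ·e₁,…,θ·e_k)|⁻²` is integrable on `S^{n-1}` with respect to the surface measure. -/
theorem statement8 (n k : ℕ) (hn : 2 ≤ n) (hk : 1 ≤ k) (hkn : k ≤ n - 1)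
    (α : ℝ) (hα : 0 < α) (hαk : α < k / 2)
    (q : EuclideanSpace ℝ (Fin k) → ℂ) (hq_cont : Continuous q)
    (hq_ell : ∀ η, q η = 0 → η = 0)
    (hq_hom : ∀ lam : ℝ, 0 < lam → ∀ η : EuclideanSpace ℝ (Fin k), η ≠ 0 →
      q (lam • η) = ((lam ^ α : ℝ) : ℂ) * q η) :
    Integrable
      (fun θ : Metric.sphere (0 : EuclideanSpace ℝ (Fin n)) 1 =>
        (‖q (projK n k (by omega) (θ : EuclideanSpace ℝ (Fin n)))‖ ^ 2)⁻¹)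
      ((volume : Measure (EuclideanSpace ℝ (Fin n))).toSphere) := by
  obtain ⟨m, rfl⟩ : ∃ m, n = k + m := ⟨n - k, by omega⟩
  have hP : Continuous (projK (k + m) k (by omega)) := by
    unfold projK
    fun_prop
  have hqm : Measurable fun η => (‖q η‖ ^ 2)⁻¹ := by
    have := hq_cont.measurable
    fun_prop
  have hm := hqm.comp hP.measurable
  refine ⟨(hm.comp measurable_subtype_coe).aestronglyMeasurable, ?_⟩
  rw [hasFiniteIntegral_iff_ofReal (Filter.Eventually.of_forall fun θ => by positivity)]
  refine lt_of_le_of_lt (sphere_le volume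
    (fun x => ENNReal.ofReal ((‖q (projK (k + m) k (by omega) x)‖ ^ 2)⁻¹))
    hm.ennreal_ofReal ?_) ?_
  · intro x r hr hr1
    apply ENNReal.ofReal_le_ofReal
    have hs : projK (k + m) k (by omega) (r • x) = r • projK (k + m) k (by omega) x := by
      ext i; rfl
    rw [hs]
    by_cases h0 : projK (k + m) k (by omega) x = 0
    · simp [h0]
    rw [hq_hom r hr _ h0, norm_mul, Complex.norm_real, Real.norm_of_nonneg (by positivity)]
    have hpos : 0 < ‖q (projK (k + m) k (by omega) x)‖ :=
      norm_pos_iff.2 fun h => h0 (hq_ell _ h)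
    have hr2 : 0 < r ^ α := by positivity
    have hr3 : r ^ α ≤ 1 := Real.rpow_le_one hr.le hr1.le hα.le
    gcongr
    exact mul_le_of_le_one_left hpos.le hr3
  · exact ENNReal.mul_lt_top (ENNReal.natCast_lt_top _)
      (proj_ball k m _ hqm.ennreal_ofReal (q_ball hk α hα hαk q hq_cont hq_ell hq_hom))
end

section
/- Let n ≥ 2, 1 ≤ k ≤ n − 1 and 0 < α < k/2, and let q : ℝ^k → ℂ be as in the standing assumptions. Then for every ξ ∈ ℝⁿ \ {0}, ∫_{SO(n)} |ξ|^{2α} · |q(⟨Qe₁, ξ⟩, …, ⟨Qe_k, ξ⟩)|^{−2} dμ(Q) = S(S^{n−1})^{−1} ∫_{S^{n−1}} |q(θ·e₁, …, θ·e_k)|^{−2} dS(θ), both sides being finite. -/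
open MeasureTheory

instance matrixMeasurableSpace (n : ℕ) : MeasurableSpace (Matrix (Fin n) (Fin n) ℝ) :=
  MeasurableSpace.pi

/-- The vector `(⟨Qe₁, ξ⟩, …, ⟨Qe_k, ξ⟩) ∈ ℝ^k`, where `Qe_i` is the `i`-th column of `Q`. -/
noncomputable def rotProj (n k : ℕ) (hkn : k ≤ n) (Q : Matrix (Fin n) (Fin n) ℝ)
    (ξ : EuclideanSpace ℝ (Fin n)) : EuclideanSpace ℝ (Fin k) :=
  (EuclideanSpace.equiv (Fin k) ℝ).symm fun i => ∑ j, Q j (Fin.castLE hkn i) * ξ j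

open Metric Set Module
open scoped Pointwise

lemma aux_oneD (s : ℝ) (hs : s < 1) :
    Integrable (fun t : ℝ => (Icc (-1:ℝ) 1).indicator (fun t => |t| ^ (-s)) t) := by
  rw [integrable_indicator_iff measurableSet_Icc]
  have h1 : IntervalIntegrable (fun t : ℝ => t ^ (-s)) volume 0 1 :=
    intervalIntegral.intervalIntegrable_rpow' (by linarith)
  have hp : IntervalIntegrable (fun t : ℝ => |t| ^ (-s)) volume 0 1 := by
    refine h1.congr ?_
    intro t ht
    rw [uIoc_of_le zero_le_one] at ht
    simp [abs_of_pos ht.1]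
  have hm : IntervalIntegrable (fun t : ℝ => |t| ^ (-s)) volume (-1) 0 := by
    have := (IntervalIntegrable.iff_comp_neg).1 hp
    simpa using this.symm
  have := hm.trans hp
  rw [intervalIntegrable_iff_integrableOn_Icc_of_le (by norm_num)] at this
  exact this

lemma aux_cube (n : ℕ) (s : ℝ) (hs : s < 1) :
    ∫⁻ x : Fin n → ℝ, ENNReal.ofReal
      (∏ i, (Icc (-1:ℝ) 1).indicator (fun t => |t| ^ (-s)) (x i)) < ⊤ := by
  have := Integrable.fintype_prod (ι := Fin n)
    (f := fun _ => (fun t : ℝ => (Icc (-1:ℝ) 1).indicator (fun t => |t| ^ (-s)) t))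
    (μ := fun _ => (volume : Measure ℝ)) (fun _ => aux_oneD s hs)
  exact this.lintegral_lt_top

lemma aux_ball (n k : ℕ) (hkn : k ≤ n) (hk : 1 ≤ k) (α : ℝ) (hα : 0 < α) (hαk : α < k / 2)
    (f : EuclideanSpace ℝ (Fin n) → ENNReal) (C : ℝ)
    (hC : 0 ≤ C)
    (hf2 : ∀ x, (∀ i, x i ≠ 0) →
      f x ≤ ENNReal.ofReal (C * ‖rotProj n k hkn 1 x‖ ^ (-(2 * α)))) :
    ∫⁻ x in ball (0 : EuclideanSpace ℝ (Fin n)) 1, f x < ⊤ := by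
  have hk0 : (0:ℝ) < k := by exact_mod_cast hk
  set s : ℝ := 2 * α / k with hs_def
  have hs : s < 1 := by rw [hs_def, div_lt_one hk0]; linarith
  have hs0 : 0 < s := by positivity
  have hsk : s * k = 2 * α := by rw [hs_def]; field_simp
  set G : (Fin n → ℝ) → ℝ := fun x =>
    ∏ i, (Icc (-1:ℝ) 1).indicator (fun t => |t| ^ (-s)) (x i) with hG
  have hae : ∀ᵐ x : EuclideanSpace ℝ (Fin n), ∀ i, x i ≠ 0 := by
    rw [ae_all_iff]
    intro i
    have h1 : ∀ᵐ x : Fin n → ℝ, x i ≠ 0 := by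
      exact Measure.ae_eval_ne (μ := fun _ => (volume : Measure ℝ)) i 0
    exact (PiLp.volume_preserving_ofLp (Fin n)).quasiMeasurePreserving.ae h1
  have hpt : ∀ x ∈ ball (0 : EuclideanSpace ℝ (Fin n)) 1, (∀ i, x i ≠ 0) →
      f x ≤ ENNReal.ofReal C * ENNReal.ofReal (G (WithLp.ofLp x)) := by
    intro x hx hx0
    refine (hf2 x hx0).trans ?_
    rw [← ENNReal.ofReal_mul hC]
    refine ENNReal.ofReal_le_ofReal (mul_le_mul_of_nonneg_left ?_ hC)
    have hle : ∀ i, |x i| ≤ 1 := fun i => by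
      have := PiLp.norm_apply_le x i
      rw [mem_ball_zero_iff] at hx
      rw [Real.norm_eq_abs] at this
      linarith
    have hG' : G (WithLp.ofLp x) = ∏ i, |x i| ^ (-s) := by
      refine Finset.prod_congr rfl fun i _ => ?_
      rw [indicator_of_mem]
      exact abs_le.1 (hle i)
    have hone : ∀ i, 1 ≤ |x i| ^ (-s) := fun i =>
      Real.one_le_rpow_of_pos_of_le_one_of_nonpos (abs_pos.2 (hx0 i)) (hle i) (by linarith)
    have hcomp : ∀ i : Fin k, rotProj n k hkn 1 x i = x (Fin.castLE hkn i) := by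
      intro i
      simp [rotProj, Matrix.one_apply]
    have hy : ∀ i : Fin k, ‖rotProj n k hkn 1 x‖ ^ (-s) ≤ |x (Fin.castLE hkn i)| ^ (-s) := by
      intro i
      refine Real.rpow_le_rpow_of_nonpos (abs_pos.2 (hx0 _)) ?_ (by linarith)
      rw [← hcomp, ← Real.norm_eq_abs]
      exact PiLp.norm_apply_le _ i
    rw [hG']
    calc ‖rotProj n k hkn 1 x‖ ^ (-(2 * α))
        = (‖rotProj n k hkn 1 x‖ ^ (-s)) ^ k := by
          rw [← Real.rpow_natCast, ← Real.rpow_mul (norm_nonneg _), ← hsk, neg_mul]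
      _ = ∏ i : Fin k, ‖rotProj n k hkn 1 x‖ ^ (-s) := by simp
      _ ≤ ∏ i : Fin k, |x (Fin.castLE hkn i)| ^ (-s) :=
          Finset.prod_le_prod (fun i _ => by positivity) fun i _ => hy i
      _ = ∏ i ∈ Finset.univ.map (Fin.castLEEmb hkn), |x i| ^ (-s) := by
          rw [Finset.prod_map]; rfl
      _ ≤ ∏ i, |x i| ^ (-s) := by
          rw [← Finset.prod_mul_prod_compl (Finset.univ.map (Fin.castLEEmb hkn))
            (fun i => |x i| ^ (-s))]
          refine le_mul_of_one_le_right (Finset.prod_nonneg fun i _ => by positivity) ?_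
          calc (1:ℝ) = ∏ i ∈ (Finset.univ.map (Fin.castLEEmb hkn))ᶜ, (1:ℝ) := by simp
            _ ≤ _ := Finset.prod_le_prod (fun _ _ => zero_le_one) fun i _ => hone i
  calc ∫⁻ x in ball (0 : EuclideanSpace ℝ (Fin n)) 1, f x
      ≤ ∫⁻ x in ball (0 : EuclideanSpace ℝ (Fin n)) 1,
          ENNReal.ofReal C * ENNReal.ofReal (G (WithLp.ofLp x)) := by
        refine lintegral_mono_ae ?_
        filter_upwards [ae_restrict_mem measurableSet_ball, ae_restrict_of_ae hae] with x h1 h2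
        exact hpt x h1 h2
    _ ≤ ∫⁻ x : EuclideanSpace ℝ (Fin n),
          ENNReal.ofReal C * ENNReal.ofReal (G (WithLp.ofLp x)) := setLIntegral_le_lintegral _ _
    _ = ENNReal.ofReal C * ∫⁻ x : EuclideanSpace ℝ (Fin n),
          ENNReal.ofReal (G (WithLp.ofLp x)) := lintegral_const_mul' _ _ ENNReal.ofReal_ne_top
    _ = ENNReal.ofReal C * ∫⁻ x : Fin n → ℝ, ENNReal.ofReal (G x) := by
        rw [(PiLp.volume_preserving_ofLp (Fin n)).lintegral_comp_emb
          (MeasurableEquiv.toLp 2 (Fin n → ℝ)).symm.measurableEmbedding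
            (fun x => ENNReal.ofReal (G x))]
    _ < ⊤ := ENNReal.mul_lt_top ENNReal.ofReal_lt_top (aux_cube n s hs)

lemma aux_polar {E : Type*} [NormedAddCommGroup E] [InnerProductSpace ℝ E] [FiniteDimensional ℝ E]
    [MeasurableSpace E] [BorelSpace E] [Nontrivial E]
    (f : E → ENNReal) (hfm : Measurable f)
    (hmono : ∀ r : ℝ, 0 < r → r < 1 → ∀ x, f x ≤ f (r • x))
    (hfin : ∫⁻ x in ball (0 : E) 1, f x < ⊤) :
    ∫⁻ θ : sphere (0 : E) 1, f θ ∂((volume : Measure E).toSphere) < ⊤ := by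
  set d := finrank ℝ E - 1
  set r1 : Ioi (0:ℝ) := ⟨1, mem_Ioi.2 one_pos⟩
  have hmp := (volume : Measure E).measurePreserving_homeomorphUnitSphereProd
  set g : E → ENNReal := (ball (0:E) 1).indicator f with hg
  have hgm : Measurable g := hfm.indicator measurableSet_ball
  have h1 : ∫⁻ x : ({0}ᶜ : Set E), g x ∂((volume : Measure E).comap (↑)) ≤
      ∫⁻ x in ball (0 : E) 1, f x := by
    rw [lintegral_subtype_comap (measurableSet_singleton _).compl g,
      ← lintegral_indicator measurableSet_ball]
    exact setLIntegral_le_lintegral _ _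
  have h2 : ∫⁻ x : ({0}ᶜ : Set E), g x ∂((volume : Measure E).comap (↑)) =
      ∫⁻ p : sphere (0:E) 1 × Ioi (0:ℝ), g (p.2.1 • p.1.1)
        ∂((volume : Measure E).toSphere.prod (Measure.volumeIoiPow d)) := by
    rw [← hmp.lintegral_comp_emb (Homeomorph.measurableEmbedding _)]
    refine lintegral_congr fun x => ?_
    congr 1
    have hx : ‖x.1‖ ≠ 0 := norm_ne_zero_iff.2 x.2
    simp [smul_smul, hx]
  have hvol : Measure.volumeIoiPow d (Iio r1) ≠ 0 := by
    rw [Measure.volumeIoiPow_apply_Iio]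
    simp [r1]
    positivity
  have h3 : (∫⁻ θ : sphere (0 : E) 1, f θ ∂((volume : Measure E).toSphere)) *
      Measure.volumeIoiPow d (Iio r1) ≤
      ∫⁻ p : sphere (0:E) 1 × Ioi (0:ℝ), g (p.2.1 • p.1.1)
        ∂((volume : Measure E).toSphere.prod (Measure.volumeIoiPow d)) := by
    have hfθ : Measurable fun θ : sphere (0:E) 1 => f θ := hfm.comp measurable_subtype_coe
    have : Measure.volumeIoiPow d (Iio r1) =
      ∫⁻ r, (Iio r1).indicator 1 r ∂(Measure.volumeIoiPow d) := by
      rw [lintegral_indicator_one measurableSet_Iio]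
    rw [this, ← lintegral_prod_mul hfθ.aemeasurable
      (measurable_one.indicator measurableSet_Iio).aemeasurable]
    refine lintegral_mono fun p => ?_
    by_cases hp : p.2 ∈ Iio r1
    · have hlt : p.2.1 < 1 := hp
      have hpos : 0 < p.2.1 := p.2.2
      have hmem : p.2.1 • p.1.1 ∈ ball (0:E) 1 := by
        rw [mem_ball_zero_iff, norm_smul, Real.norm_of_nonneg hpos.le]
        simpa using hlt
      simp only [indicator_of_mem hp, hg, indicator_of_mem hmem]
      simpa using hmono _ hpos hlt _
    · simp [indicator_of_notMem hp]
  have h4 := (h3.trans_eq h2.symm).trans h1 |>.trans_lt hfin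
  by_contra hcon
  rw [not_lt, top_le_iff] at hcon
  rw [hcon, ENNReal.top_mul hvol] at h4
  exact lt_irrefl _ h4

lemma aux_inv {E : Type*} [NormedAddCommGroup E] [InnerProductSpace ℝ E] [FiniteDimensional ℝ E]
    [MeasurableSpace E] [BorelSpace E]
    (f : E → ENNReal) (hfm : Measurable f) (A : E ≃ₗᵢ[ℝ] E) :
    ∫⁻ θ : sphere (0 : E) 1, f (A θ) ∂((volume : Measure E).toSphere) =
    ∫⁻ θ : sphere (0 : E) 1, f θ ∂((volume : Measure E).toSphere) := by
  let T : sphere (0:E) 1 → sphere (0:E) 1 := fun θ => ⟨A θ, by simp⟩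
  have hT : Measurable T := by
    refine Measurable.subtype_mk ?_
    exact A.continuous.measurable.comp measurable_subtype_coe
  have hmap : ((volume : Measure E).toSphere).map T = (volume : Measure E).toSphere := by
    ext s hs
    rw [Measure.map_apply hT hs, Measure.toSphere_apply' _ (hT hs), Measure.toSphere_apply' _ hs]
    congr 1
    rw [← MeasurePreserving.measure_preimage_emb A.measurePreserving
      A.toHomeomorph.measurableEmbedding (Ioo (0:ℝ) 1 • Set.image Subtype.val s)]
    congr 1
    ext x
    simp only [mem_smul, mem_image, mem_preimage]
    constructor
    · rintro ⟨r, hr, _, ⟨θ, hθ, rfl⟩, rfl⟩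
      exact ⟨r, hr, A θ, ⟨T θ, hθ, rfl⟩, by simp⟩
    · rintro ⟨r, hr, _, ⟨θ, hθ, rfl⟩, h⟩
      refine ⟨r, hr, A.symm θ, ⟨⟨A.symm θ, by simp⟩, ?_, rfl⟩, ?_⟩
      · simpa [T] using hθ
      · apply A.injective
        simpa using h
  have h := lintegral_map (μ := (volume : Measure E).toSphere)
    (hfm.comp (measurable_subtype_coe (p := fun x => x ∈ sphere (0:E) 1))) hT
  rw [hmap] at h
  exact h.symm

lemma aux_trans (n : ℕ) (hn : 2 ≤ n) (u v : EuclideanSpace ℝ (Fin n)) (h : ‖u‖ = ‖v‖) :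
    ∃ A : EuclideanSpace ℝ (Fin n) ≃ₗᵢ[ℝ] EuclideanSpace ℝ (Fin n),
      LinearMap.det (A.toLinearEquiv : EuclideanSpace ℝ (Fin n) →ₗ[ℝ] EuclideanSpace ℝ (Fin n)) = 1
      ∧ A u = v := by
  have hdet : ∀ w : EuclideanSpace ℝ (Fin n), w ≠ 0 →
      LinearMap.det (((ℝ ∙ w)ᗮ).reflection.toLinearEquiv :
        EuclideanSpace ℝ (Fin n) →ₗ[ℝ] EuclideanSpace ℝ (Fin n)) = -1 := by
    intro w hw
    have := Submodule.det_reflection (𝕜 := ℝ) ((ℝ ∙ w)ᗮ)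
    rw [Submodule.orthogonal_orthogonal, finrank_span_singleton hw, pow_one] at this
    exact this
  by_cases huv : u = v
  · exact ⟨LinearIsometryEquiv.refl ℝ _, by simp, by simpa using huv⟩
  obtain ⟨w, hw, hw0⟩ : ∃ w ∈ (ℝ ∙ v)ᗮ, w ≠ 0 := by
    apply Submodule.exists_mem_ne_zero_of_ne_bot
    intro hbot
    have h1 := Submodule.finrank_add_finrank_orthogonal (ℝ ∙ v)
    rw [hbot, finrank_bot] at h1
    have h2 := finrank_span_singleton (K := ℝ) (v := v) (by
      rintro rfl
      exact huv (norm_eq_zero.1 (by simpa using h)))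
    simp at h1
    omega
  refine ⟨((ℝ ∙ (u - v))ᗮ).reflection.trans ((ℝ ∙ w)ᗮ).reflection, ?_, ?_⟩
  · have h1 := hdet w hw0
    have h2 := hdet (u - v) (sub_ne_zero.2 huv)
    have : LinearMap.det ((((ℝ ∙ w)ᗮ).reflection.toLinearEquiv :
        EuclideanSpace ℝ (Fin n) →ₗ[ℝ] EuclideanSpace ℝ (Fin n)) ∘ₗ
        (((ℝ ∙ (u - v))ᗮ).reflection.toLinearEquiv :
        EuclideanSpace ℝ (Fin n) →ₗ[ℝ] EuclideanSpace ℝ (Fin n))) = 1 := by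
      rw [LinearMap.det_comp, h1, h2]; norm_num
    exact this
  · rw [LinearIsometryEquiv.trans_apply, Submodule.reflection_sub h]
    apply Submodule.reflection_mem_subspace_eq_self
    rw [Submodule.mem_orthogonal_singleton_iff_inner_right] at hw ⊢
    rw [real_inner_comm]; exact hw

/-- the action of the transpose -/
noncomputable def tAct (n : ℕ) (Q : Matrix (Fin n) (Fin n) ℝ) (x : EuclideanSpace ℝ (Fin n)) :
    EuclideanSpace ℝ (Fin n) := WithLp.toLp 2 (fun i => ∑ j, Q j i * x j)

lemma rotProj_eq (n k : ℕ) (hkn : k ≤ n) (Q : Matrix (Fin n) (Fin n) ℝ)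
    (x : EuclideanSpace ℝ (Fin n)) : rotProj n k hkn Q x = rotProj n k hkn 1 (tAct n Q x) := by
  ext i
  simp [rotProj, tAct, Matrix.one_apply]

lemma tAct_mul (n : ℕ) (P Q : Matrix (Fin n) (Fin n) ℝ) (x : EuclideanSpace ℝ (Fin n)) :
    tAct n (P * Q) x = tAct n Q (tAct n P x) := by
  ext i
  simp only [tAct, Matrix.mul_apply, Finset.sum_mul, Finset.mul_sum]
  rw [Finset.sum_comm]
  refine Finset.sum_congr rfl fun j _ => Finset.sum_congr rfl fun l _ => by ring

lemma tAct_one (n : ℕ) (x : EuclideanSpace ℝ (Fin n)) : tAct n 1 x = x := by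
  ext i
  simp [tAct, Matrix.one_apply]

lemma tAct_isom (n : ℕ) (Q : Matrix (Fin n) (Fin n) ℝ)
    (hQ : Q ∈ Matrix.specialOrthogonalGroup (Fin n) ℝ) :
    ∃ A : EuclideanSpace ℝ (Fin n) ≃ₗᵢ[ℝ] EuclideanSpace ℝ (Fin n), ∀ x, A x = tAct n Q x := by
  have hQQ : Q * star Q = 1 := Matrix.mem_orthogonalGroup_iff (n := Fin n) (R := ℝ) |>.1
    (Matrix.mem_specialOrthogonalGroup_iff.1 hQ).1
  let L : EuclideanSpace ℝ (Fin n) →ₗ[ℝ] EuclideanSpace ℝ (Fin n) :=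
    { toFun := tAct n Q
      map_add' := fun x y => by
        ext i; simp [tAct, mul_add, Finset.sum_add_distrib]
      map_smul' := fun c x => by
        ext i; simp [tAct, Finset.mul_sum]; exact Finset.sum_congr rfl fun j _ => by ring }
  have hL : ∀ x, ‖L x‖ = ‖x‖ := by
    intro x
    have key : inner ℝ (L x) (L x) = inner ℝ x (tAct n (star Q) (L x)) := by
      change inner ℝ (tAct n Q x) _ = _
      simp only [tAct, PiLp.inner_apply, Matrix.star_apply, star_trivial, RCLike.inner_apply,
        conj_trivial, Finset.mul_sum, Finset.sum_mul]
      rw [Finset.sum_comm]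
      refine Finset.sum_congr rfl fun j _ => Finset.sum_congr rfl fun l _ => by ring
    have h2 : tAct n (star Q) (L x) = x := by
      change tAct n (star Q) (tAct n Q x) = x
      rw [← tAct_mul, hQQ, tAct_one]
    rw [h2, real_inner_self_eq_norm_sq, real_inner_self_eq_norm_sq] at key
    exact (sq_eq_sq₀ (norm_nonneg _) (norm_nonneg _)).1 key
  exact ⟨LinearIsometry.toLinearIsometryEquiv ⟨L, hL⟩ rfl, fun x => rfl⟩

lemma aux_trans_mat (n : ℕ) (hn : 2 ≤ n) (u v : EuclideanSpace ℝ (Fin n)) (h : ‖u‖ = ‖v‖) :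
    ∃ P : Matrix.specialOrthogonalGroup (Fin n) ℝ, tAct n P u = v := by
  obtain ⟨A, hdet, hA⟩ := aux_trans n hn u v h
  let b := EuclideanSpace.basisFun (Fin n) ℝ
  set M := LinearMap.toMatrix b.toBasis b.toBasis
    (A.toLinearEquiv : EuclideanSpace ℝ (Fin n) →ₗ[ℝ] EuclideanSpace ℝ (Fin n)) with hM
  have hMdet : M.det = 1 := by rw [hM, LinearMap.det_toMatrix, hdet]
  have hMu : M ∈ Matrix.unitaryGroup (Fin n) ℝ := by
    have := b.toMatrix_orthonormalBasis_mem_unitary (b.map A)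
    convert this using 1
    ext i j
    simp [hM, LinearMap.toMatrix_apply, Basis.toMatrix_apply]
  have hmem : M.transpose ∈ Matrix.specialOrthogonalGroup (Fin n) ℝ := by
    rw [Matrix.mem_specialOrthogonalGroup_iff]
    exact ⟨Matrix.transpose_mem_unitaryGroup_iff.2 hMu, by rw [Matrix.det_transpose, hMdet]⟩
  refine ⟨⟨M.transpose, hmem⟩, ?_⟩
  rw [← hA]
  ext i
  have := congrFun (LinearMap.toMatrix_mulVec_repr b.toBasis b.toBasis
    (A.toLinearEquiv : EuclideanSpace ℝ (Fin n) →ₗ[ℝ] EuclideanSpace ℝ (Fin n)) u) i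
  simpa [tAct, Matrix.mulVec, dotProduct, b] using this

/-- For `n ≥ 2`, `1 ≤ k ≤ n-1`, `0 < α < k/2`, and `μ` the normalized Haar
(probability) measure on `SO(n)`: for every `ξ ≠ 0`,
`∫_{SO(n)} |ξ|^{2α} |q(⟨Qe₁,ξ⟩,…,⟨Qe_k,ξ⟩)|⁻² dμ(Q)
  = S(S^{n-1})⁻¹ ∫_{S^{n-1}} |q(θ·e₁,…,θ·e_k)|⁻² dS(θ)`, both sides being finite. -/
theorem statement9 (n k : ℕ) (hn : 2 ≤ n) (hk : 1 ≤ k) (hkn : k ≤ n - 1)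
    (α : ℝ) (hα : 0 < α) (hαk : α < k / 2)
    (q : EuclideanSpace ℝ (Fin k) → ℂ) (hq_cont : Continuous q)
    (hq_ell : ∀ η, q η = 0 → η = 0)
    (hq_hom : ∀ lam : ℝ, 0 < lam → ∀ η : EuclideanSpace ℝ (Fin k), η ≠ 0 →
      q (lam • η) = ((lam ^ α : ℝ) : ℂ) * q η)
    (μ : Measure ↥(Matrix.specialOrthogonalGroup (Fin n) ℝ))
    (hμ_prob : IsProbabilityMeasure μ)
    (hμ_inv : ∀ P : ↥(Matrix.specialOrthogonalGroup (Fin n) ℝ),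
      μ.map (fun Q => P * Q) = μ) :
    (∫⁻ θ : Metric.sphere (0 : EuclideanSpace ℝ (Fin n)) 1,
        ENNReal.ofReal
          ((‖q (rotProj n k (by omega) 1 (θ : EuclideanSpace ℝ (Fin n)))‖ ^ 2)⁻¹)
      ∂((volume : Measure (EuclideanSpace ℝ (Fin n))).toSphere)) < ⊤ ∧
    ∀ ξ : EuclideanSpace ℝ (Fin n), ξ ≠ 0 →
      (∫⁻ Q : ↥(Matrix.specialOrthogonalGroup (Fin n) ℝ),
          ENNReal.ofReal
            (‖ξ‖ ^ (2 * α) * (‖q (rotProj n k (by omega) (Q : Matrix (Fin n) (Fin n) ℝ) ξ)‖ ^ 2)⁻¹)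
        ∂μ) =
      (((volume : Measure (EuclideanSpace ℝ (Fin n))).toSphere Set.univ))⁻¹ *
        ∫⁻ θ : Metric.sphere (0 : EuclideanSpace ℝ (Fin n)) 1,
          ENNReal.ofReal
            ((‖q (rotProj n k (by omega) 1 (θ : EuclideanSpace ℝ (Fin n)))‖ ^ 2)⁻¹)
        ∂((volume : Measure (EuclideanSpace ℝ (Fin n))).toSphere) := by
  have hkn' : k ≤ n := by omega
  have hkpos : (0:ℝ) < k := by exact_mod_cast hk
  have : Nonempty (Fin k) := ⟨⟨0, hk⟩⟩
  have : Nonempty (Fin n) := ⟨⟨0, by omega⟩⟩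
  have : Nontrivial (EuclideanSpace ℝ (Fin n)) := inferInstance
  have : Nontrivial (EuclideanSpace ℝ (Fin k)) := inferInstance
  -- `q 0 = 0`
  have hq0 : q 0 = 0 := by
    obtain ⟨η, hη⟩ := exists_ne (0 : EuclideanSpace ℝ (Fin k))
    have h1 : Filter.Tendsto (fun l : ℝ => q (l • η)) (nhdsWithin 0 (Ioi 0)) (nhds (q 0)) := by
      have : Continuous fun l : ℝ => q (l • η) := by fun_prop
      have := this.tendsto 0
      rw [zero_smul] at this
      exact this.mono_left nhdsWithin_le_nhds
    have h2 : Filter.Tendsto (fun l : ℝ => ((l ^ α : ℝ) : ℂ) * q η) (nhdsWithin 0 (Ioi 0))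
        (nhds 0) := by
      have hc : Continuous fun l : ℝ => ((l ^ α : ℝ) : ℂ) * q η := by
        have := Real.continuous_rpow_const hα.le
        fun_prop
      have := hc.tendsto 0
      rw [Real.zero_rpow hα.ne'] at this
      simp only [Complex.ofReal_zero, zero_mul] at this
      exact this.mono_left nhdsWithin_le_nhds
    refine tendsto_nhds_unique h1 (h2.congr' ?_)
    filter_upwards [self_mem_nhdsWithin] with l hl
    exact (hq_hom l hl η hη).symm
  have hom : ∀ lam : ℝ, 0 < lam → ∀ η : EuclideanSpace ℝ (Fin k),
      ‖q (lam • η)‖ = lam ^ α * ‖q η‖ := by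
    intro lam hl η
    by_cases hη : η = 0
    · simp [hη, hq0]
    · rw [hq_hom lam hl η hη, norm_mul, Complex.norm_real, Real.norm_of_nonneg (by positivity)]
  -- lower bound
  obtain ⟨c, hc, hcb⟩ : ∃ c : ℝ, 0 < c ∧ ∀ η : EuclideanSpace ℝ (Fin k), η ≠ 0 →
      c * ‖η‖ ^ α ≤ ‖q η‖ := by
    obtain ⟨η₀, hη₀, hmin⟩ := (isCompact_sphere (0 : EuclideanSpace ℝ (Fin k)) 1).exists_isMinOn
      (NormedSpace.sphere_nonempty.2 zero_le_one) (hq_cont.norm.continuousOn)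
    refine ⟨‖q η₀‖, norm_pos_iff.2 fun h => ?_, fun η hη => ?_⟩
    · have := hq_ell _ h
      simp [this] at hη₀
    · have hpos : 0 < ‖η‖ := norm_pos_iff.2 hη
      have h1 : ‖q η₀‖ ≤ ‖q (‖η‖⁻¹ • η)‖ := by
        apply hmin
        simp [norm_smul, hpos.ne']
      have h2 := hom ‖η‖ hpos (‖η‖⁻¹ • η)
      rw [smul_smul, mul_inv_cancel₀ hpos.ne', one_smul] at h2
      rw [h2, mul_comm]
      gcongr
  set f : EuclideanSpace ℝ (Fin n) → ENNReal := fun x =>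
    ENNReal.ofReal ((‖q (rotProj n k hkn' 1 x)‖ ^ 2)⁻¹) with hf
  have hlin : ∀ (r : ℝ) x, rotProj n k hkn' 1 (r • x) = r • rotProj n k hkn' 1 x := by
    intro r x
    ext i
    simp [rotProj, Matrix.one_apply]
  have hrot : Continuous (rotProj n k hkn' 1) := by
    unfold rotProj
    fun_prop
  have hfm : Measurable f := by
    have : Measurable fun x => ‖q (rotProj n k hkn' 1 x)‖ := (by fun_prop : Continuous _).measurable
    exact ((this.pow_const 2).inv).ennreal_ofReal
  have hfhom : ∀ r : ℝ, 0 < r → ∀ x,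
      (‖q (rotProj n k hkn' 1 (r • x))‖ ^ 2)⁻¹ =
        r ^ (-(2 * α)) * (‖q (rotProj n k hkn' 1 x)‖ ^ 2)⁻¹ := by
    intro r hr x
    rw [hlin, hom r hr, mul_pow, mul_inv, Real.rpow_neg hr.le, mul_comm 2 α, Real.rpow_mul hr.le]
    norm_num
  have hfin : (∫⁻ θ : sphere (0 : EuclideanSpace ℝ (Fin n)) 1, f θ
      ∂((volume : Measure (EuclideanSpace ℝ (Fin n))).toSphere)) < ⊤ := by
    refine aux_polar f hfm ?_ ?_
    · intro r hr hr1 x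
      refine ENNReal.ofReal_le_ofReal ?_
      rw [hfhom r hr]
      exact le_mul_of_one_le_left (by positivity)
        (Real.one_le_rpow_of_pos_of_le_one_of_nonpos hr hr1.le (by linarith))
    · refine aux_ball n k hkn' hk α hα hαk f ((c ^ 2)⁻¹) (by positivity) fun x hx => ?_
      refine ENNReal.ofReal_le_ofReal ?_
      by_cases hy : rotProj n k hkn' 1 x = 0
      · rw [hy, hq0]
        simp
        positivity
      · have hpos : 0 < ‖rotProj n k hkn' 1 x‖ := norm_pos_iff.2 hy
        have h1 := hcb _ hy
        calc (‖q (rotProj n k hkn' 1 x)‖ ^ 2)⁻¹ ≤ ((c * ‖rotProj n k hkn' 1 x‖ ^ α) ^ 2)⁻¹ := by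
              gcongr
          _ = _ := by
              rw [mul_pow, mul_inv, Real.rpow_neg hpos.le, mul_comm 2 α, Real.rpow_mul hpos.le]
              norm_num
  refine ⟨hfin, fun ξ hξ => ?_⟩
  have hξpos : 0 < ‖ξ‖ := norm_pos_iff.2 hξ
  set σ := (volume : Measure (EuclideanSpace ℝ (Fin n))).toSphere with hσ
  set F : EuclideanSpace ℝ (Fin n) → ENNReal := fun u =>
    ∫⁻ Q : ↥(Matrix.specialOrthogonalGroup (Fin n) ℝ), f (tAct n Q u) ∂μ with hF
  have hentry : ∀ i j, Measurable
      fun Q : ↥(Matrix.specialOrthogonalGroup (Fin n) ℝ) => (Q : Matrix (Fin n) (Fin n) ℝ) i j :=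
    by
    intro i j
    have h1 : Measurable fun Q : Matrix (Fin n) (Fin n) ℝ => Q i :=
      measurable_pi_apply (X := fun _ : Fin n => Fin n → ℝ) i
    have h2 : Measurable fun v : Fin n → ℝ => v j := measurable_pi_apply j
    exact (h2.comp h1).comp measurable_subtype_coe
  have hjoint : Measurable fun p : ↥(Matrix.specialOrthogonalGroup (Fin n) ℝ) ×
      EuclideanSpace ℝ (Fin n) => tAct n p.1 p.2 := by
    unfold tAct
    refine (WithLp.measurable_toLp 2 _).comp (measurable_pi_lambda _ fun i => ?_)
    refine Finset.measurable_sum _ fun j _ => ?_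
    refine ((hentry j i).comp measurable_fst).mul ?_
    have : Measurable fun x : EuclideanSpace ℝ (Fin n) => x j := by fun_prop
    exact this.comp measurable_snd
  have hact : ∀ u, Measurable fun Q : ↥(Matrix.specialOrthogonalGroup (Fin n) ℝ) => tAct n Q u :=
    fun u => hjoint.comp (measurable_id.prodMk measurable_const)
  have hmul : ∀ P : ↥(Matrix.specialOrthogonalGroup (Fin n) ℝ), Measurable fun Q => P * Q := by
    intro P
    refine Measurable.subtype_mk ?_
    refine measurable_pi_lambda _ fun i => measurable_pi_lambda _ fun j => ?_
    simp only [Matrix.mul_apply]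
    exact Finset.measurable_sum _ fun l _ => (hentry l j).const_mul _
  have hFinv : ∀ (P : ↥(Matrix.specialOrthogonalGroup (Fin n) ℝ)) u, F (tAct n P u) = F u := by
    intro P u
    have h := lintegral_map (μ := μ) (hfm.comp (hact u)) (hmul P)
    rw [hμ_inv P] at h
    simp only [hF]
    refine Eq.trans ?_ h.symm
    refine lintegral_congr fun Q => ?_
    simp only [Function.comp]
    rw [← tAct_mul]
    rfl
  set u : EuclideanSpace ℝ (Fin n) := ‖ξ‖⁻¹ • ξ with hu
  have hunorm : ‖u‖ = 1 := by simp [hu, norm_smul, hξpos.ne']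
  have hconst : ∀ θ : sphere (0 : EuclideanSpace ℝ (Fin n)) 1, F θ = F u := by
    intro θ
    obtain ⟨P, hP⟩ := aux_trans_mat n hn u θ (by simp [hunorm])
    rw [← hP, hFinv]
  have hswap : ∫⁻ θ : sphere (0 : EuclideanSpace ℝ (Fin n)) 1, F θ ∂σ =
      ∫⁻ θ : sphere (0 : EuclideanSpace ℝ (Fin n)) 1, f θ ∂σ := by
    simp only [hF]
    rw [lintegral_lintegral_swap]
    · have : ∀ Q : ↥(Matrix.specialOrthogonalGroup (Fin n) ℝ),
          ∫⁻ θ : sphere (0 : EuclideanSpace ℝ (Fin n)) 1, f (tAct n Q θ) ∂σ =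
          ∫⁻ θ : sphere (0 : EuclideanSpace ℝ (Fin n)) 1, f θ ∂σ := by
        intro Q
        obtain ⟨A, hA⟩ := tAct_isom n Q Q.2
        simp only [← hA]
        exact aux_inv f hfm A
      simp only [this]
      simp
    · have : Measurable fun p : sphere (0 : EuclideanSpace ℝ (Fin n)) 1 ×
          ↥(Matrix.specialOrthogonalGroup (Fin n) ℝ) => f (tAct n p.2 p.1) :=
        hfm.comp (hjoint.comp
          (measurable_snd.prodMk (measurable_subtype_coe.comp measurable_fst)))
      exact this.aemeasurable
  simp only [hconst, lintegral_const] at hswap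
  have hσ0 : σ univ ≠ 0 := by
    rw [Ne, Measure.measure_univ_eq_zero]
    exact Measure.toSphere_ne_zero _
  have hσt : σ univ ≠ ⊤ := measure_ne_top _ _
  have hL : (∫⁻ Q : ↥(Matrix.specialOrthogonalGroup (Fin n) ℝ),
          ENNReal.ofReal (‖ξ‖ ^ (2 * α) *
            (‖q (rotProj n k hkn' (Q : Matrix (Fin n) (Fin n) ℝ) ξ)‖ ^ 2)⁻¹) ∂μ) = F u := by
    refine lintegral_congr fun Q => ?_
    simp only [hf]
    congr 1
    obtain ⟨A, hA⟩ := tAct_isom n Q Q.2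
    rw [rotProj_eq, ← hA, ← hA, hu, map_smul, hfhom _ (inv_pos.2 hξpos),
      Real.inv_rpow hξpos.le, Real.rpow_neg hξpos.le, inv_inv]
  refine hL.trans ?_
  rw [← hswap, mul_comm (F u), ← mul_assoc, ENNReal.inv_mul_cancel hσ0 hσt, one_mul]
end

section
/- Let n ≥ 2, 1 ≤ k ≤ n − 1 and k/2 ≤ α < k. There exists a constant c > 0, depending only on n, k and α, such that for every ε with 0 < ε < 1, ∫_{S^{n−1}} ( (θ·e₁)² + ⋯ + (θ·e_k)² + ε² )^{−α} dS(θ) ≥ c · 𝔤(1/ε), where 𝔤(t) = log t if α = k/2 and 𝔤(t) = t^{2α−k} if α > k/2. -/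
open MeasureTheory

/-- The volume of the box used below. -/
theorem box_volume (k m : ℕ) (a b δ : ℝ) (ha : 0 < a) (hb : 0 < b) (hδ : 0 < δ) :
    (volume : Measure (EuclideanSpace ℝ (Fin (k + m))))
      {x | ∀ i : Fin (k + m), x i ∈ Set.Ioo (if (i : ℕ) < k then 0 else a)
        (if (i : ℕ) < k then δ * b else 2 * a)} = ENNReal.ofReal (b ^ k * a ^ m * δ ^ k) := by
  have h1 : {x : EuclideanSpace ℝ (Fin (k + m)) | ∀ i : Fin (k + m),
      x i ∈ Set.Ioo (if (i : ℕ) < k then 0 else a) (if (i : ℕ) < k then δ * b else 2 * a)}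
      = (@WithLp.ofLp 2 (Fin (k + m) → ℝ)) ⁻¹' (Set.pi Set.univ fun i : Fin (k + m) =>
        Set.Ioo (if (i : ℕ) < k then 0 else a) (if (i : ℕ) < k then δ * b else 2 * a)) := by
    ext x
    simp only [Set.mem_ofPred_eq, Set.mem_preimage, Set.mem_univ_pi]
  rw [h1, (PiLp.volume_preserving_ofLp (Fin (k + m))).measure_preimage
    (MeasurableSet.univ_pi fun i => measurableSet_Ioo).nullMeasurableSet, Real.volume_pi_Ioo,
    Fin.prod_univ_add]
  have e1 : ∀ i : Fin k, ENNReal.ofReal ((if ((Fin.castAdd m i : Fin (k+m)) : ℕ) < k then δ * b else 2 * a)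
      - (if ((Fin.castAdd m i : Fin (k+m)) : ℕ) < k then 0 else a)) = ENNReal.ofReal (δ * b) := by
    intro i
    have : ((Fin.castAdd m i : Fin (k+m)) : ℕ) < k := by simp
    rw [if_pos this, if_pos this, sub_zero]
  have e2 : ∀ i : Fin m, ENNReal.ofReal ((if ((Fin.natAdd k i : Fin (k+m)) : ℕ) < k then δ * b else 2 * a)
      - (if ((Fin.natAdd k i : Fin (k+m)) : ℕ) < k then 0 else a)) = ENNReal.ofReal a := by
    intro i
    have : ¬ ((Fin.natAdd k i : Fin (k+m)) : ℕ) < k := by simp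
    rw [if_neg this, if_neg this]
    congr 1; ring
  simp_rw [e1, e2]
  rw [Finset.prod_const, Finset.prod_const, Finset.card_univ, Finset.card_univ, Fintype.card_fin,
    Fintype.card_fin, ← ENNReal.ofReal_pow (by positivity), ← ENNReal.ofReal_pow (by positivity),
    ← ENNReal.ofReal_mul (by positivity)]
  congr 1
  ring

theorem cap_measure (n k : ℕ) (hkn : k < n) (h : k ≤ n) :
    ∃ C : ℝ, 0 < C ∧ ∀ δ : ℝ, 0 < δ → δ ≤ 2 →
      ENNReal.ofReal (C * δ ^ k) ≤ ((volume : Measure (EuclideanSpace ℝ (Fin n))).toSphere)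
        {θ | ∑ i : Fin k, ((θ : EuclideanSpace ℝ (Fin n)) (Fin.castLE h i)) ^ 2 < δ ^ 2} := by
  obtain ⟨m, rfl⟩ := Nat.exists_eq_add_of_le h
  have hm : 0 < m := by omega
  set N : ℝ := ((k + m : ℕ) : ℝ) with hN
  have hN1 : 1 ≤ N := by
    rw [hN]; exact_mod_cast (by omega : 1 ≤ k + m)
  have hkN : (k : ℝ) < N := by
    rw [hN]; exact_mod_cast (by omega : k < k + m)
  have hN0 : 0 < N := by linarith
  set a : ℝ := 1 / (4 * N) with ha
  have ha0 : 0 < a := by positivity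
  have haN : a * N = 1 / 4 := by rw [ha]; field_simp
  set b : ℝ := a / N with hb
  have hb0 : 0 < b := by positivity
  have hbN : b * N = a := by rw [hb]; field_simp
  refine ⟨b ^ k * a ^ m, by positivity, fun δ hδ hδ2 => ?_⟩
  have hmeas : MeasurableSet {θ : Metric.sphere (0 : EuclideanSpace ℝ (Fin (k + m))) 1 |
      ∑ i : Fin k, ((θ : EuclideanSpace ℝ (Fin (k + m))) (Fin.castLE h i)) ^ 2 < δ ^ 2} := by
    apply IsOpen.measurableSet
    apply isOpen_lt _ continuous_const
    fun_prop
  rw [Measure.toSphere_apply' _ hmeas, ← box_volume k m a b δ ha0 hb0 hδ]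
  refine le_trans (measure_mono ?_) (le_mul_of_one_le_left zero_le ?_)
  · intro x hx
    simp only [Set.mem_ofPred_eq] at hx
    have hlow : a ^ 2 < ‖x‖ ^ 2 := by
      rw [EuclideanSpace.real_norm_sq_eq]
      have hj := hx (Fin.natAdd k ⟨0, hm⟩)
      simp only [Fin.val_natAdd, add_zero, lt_self_iff_false, if_false, Set.mem_Ioo] at hj
      calc a ^ 2 < (x (Fin.natAdd k ⟨0, hm⟩)) ^ 2 := by gcongr; exact hj.1
        _ ≤ _ := Finset.single_le_sum (f := fun i => (x i) ^ 2) (fun i _ => sq_nonneg _)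
          (Finset.mem_univ _)
    have hx0 : 0 < ‖x‖ := by
      by_contra hc
      have : ‖x‖ = 0 := le_antisymm (not_lt.1 hc) (norm_nonneg _)
      rw [this] at hlow; nlinarith [sq_nonneg a]
    have hup : ‖x‖ ^ 2 < 1 := by
      rw [EuclideanSpace.real_norm_sq_eq]
      have : ∀ i ∈ (Finset.univ : Finset (Fin (k + m))), (x i) ^ 2 ≤ (2 * a) ^ 2 := by
        intro i _
        have hi := hx i
        have hba : b ≤ a := by nlinarith
        split_ifs at hi
        · have := hi.1
          have h2 := hi.2
          have : x i ≤ 2 * a := by nlinarith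
          exact pow_le_pow_left₀ hi.1.le this 2
        · exact pow_le_pow_left₀ (ha0.le.trans hi.1.le) hi.2.le 2
      have h2 := Finset.sum_le_sum this
      rw [Finset.sum_const, Finset.card_univ, Fintype.card_fin, nsmul_eq_mul, ← hN] at h2
      have : a ≤ 1 / 4 := by nlinarith
      nlinarith
    have hx1 : ‖x‖ < 1 := by nlinarith
    have hsum : ∑ i : Fin k, (x (Fin.castLE h i)) ^ 2 < (δ * ‖x‖) ^ 2 := by
      have : ∀ i ∈ (Finset.univ : Finset (Fin k)), (x (Fin.castLE h i)) ^ 2 ≤ (δ * b) ^ 2 := by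
        intro i _
        have hi := hx (Fin.castLE h i)
        rw [if_pos (by simp), if_pos (by simp)] at hi
        exact pow_le_pow_left₀ hi.1.le hi.2.le 2
      have h2 := Finset.sum_le_sum this
      rw [Finset.sum_const, Finset.card_univ, Fintype.card_fin, nsmul_eq_mul] at h2
      have h3 : (k : ℝ) * (δ * b) ^ 2 ≤ (N * N) * (δ * b) ^ 2 := by
        gcongr; nlinarith
      have h4 : (N * N) * (δ * b) ^ 2 = δ ^ 2 * a ^ 2 := by rw [← hbN]; ring
      have h5 : δ ^ 2 * a ^ 2 < δ ^ 2 * ‖x‖ ^ 2 := by gcongr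
      rw [mul_pow]; linarith
    refine Set.mem_smul.2 ⟨‖x‖, ⟨hx0, hx1⟩, ‖x‖⁻¹ • x, ?_, ?_⟩
    · refine ⟨⟨‖x‖⁻¹ • x, ?_⟩, ?_, rfl⟩
      · rw [mem_sphere_zero_iff_norm, norm_smul, norm_inv, norm_norm, inv_mul_cancel₀ hx0.ne']
      · simp only [Set.mem_ofPred_eq, PiLp.smul_apply, smul_eq_mul, mul_pow]
        rw [← Finset.mul_sum, inv_pow, inv_mul_lt_iff₀ (by positivity)]
        rw [mul_pow] at hsum; linarith
    · rw [smul_inv_smul₀ hx0.ne']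
  · rw [finrank_euclideanSpace, Fintype.card_fin]
    exact_mod_cast (by omega : 1 ≤ k + m)

theorem statement14 (n k : ℕ) (hn : 2 ≤ n) (hk : 1 ≤ k) (hkn : k ≤ n - 1)
    (α : ℝ) (hαl : (k : ℝ) / 2 ≤ α) (hαk : α < k) :
    ∃ c : ℝ, 0 < c ∧
      ∀ ε : ℝ, 0 < ε → ε < 1 →
        c * (if 2 * α = k then Real.log (1 / ε) else (1 / ε) ^ (2 * α - k)) ≤
          ∫ θ : Metric.sphere (0 : EuclideanSpace ℝ (Fin n)) 1,
            ((∑ i : Fin k,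
                ((θ : EuclideanSpace ℝ (Fin n)) (Fin.castLE (by omega) i)) ^ 2) + ε ^ 2)
              ^ (-α)
          ∂((volume : Measure (EuclideanSpace ℝ (Fin n))).toSphere) := by
  have h : k ≤ n := by omega
  obtain ⟨C, hC, hcap⟩ := cap_measure n k (by omega) h
  have hk1 : (1 : ℝ) ≤ k := by exact_mod_cast hk
  have hα : 0 < α := by linarith
  set σ := (volume : Measure (EuclideanSpace ℝ (Fin n))).toSphere with hσ
  set S : Metric.sphere (0 : EuclideanSpace ℝ (Fin n)) 1 → ℝ := fun θ =>
    ∑ i : Fin k, ((θ : EuclideanSpace ℝ (Fin n)) (Fin.castLE h i)) ^ 2 with hS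
  have hS0 : ∀ θ, 0 ≤ S θ := fun θ => Finset.sum_nonneg fun i _ => sq_nonneg _
  have hScont : Continuous S := by rw [hS]; fun_prop
  refine ⟨C * 2 ^ (-α) * min 1 (2 * α), by positivity, fun ε hε hε1 => ?_⟩
  change _ ≤ ∫ θ, (S θ + ε ^ 2) ^ (-α) ∂σ
  have hpos : ∀ θ, 0 < S θ + ε ^ 2 := fun θ => by have := hS0 θ; positivity
  have hfcont : Continuous fun θ => (S θ + ε ^ 2) ^ (-α) :=
    (hScont.add continuous_const).rpow_const fun θ => Or.inl (hpos θ).ne'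
  have hf0 : ∀ θ, 0 ≤ (S θ + ε ^ 2) ^ (-α) := fun θ => Real.rpow_nonneg (hpos θ).le _
  have hint : Integrable (fun θ => (S θ + ε ^ 2) ^ (-α)) σ := by
    apply Continuous.integrable_of_hasCompactSupport hfcont
    exact HasCompactSupport.of_compactSpace _
  have hint0 : 0 ≤ ∫ θ, (S θ + ε ^ 2) ^ (-α) ∂σ := integral_nonneg hf0
  suffices hs : ENNReal.ofReal (C * 2 ^ (-α) * min 1 (2 * α) *
      (if 2 * α = k then Real.log (1 / ε) else (1 / ε) ^ (2 * α - k))) ≤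
      ∫⁻ t in Set.Ioi 0, σ {θ | t < (S θ + ε ^ 2) ^ (-α)} by
    rw [← lintegral_eq_lintegral_meas_lt σ (Filter.Eventually.of_forall hf0)
      hfcont.measurable.aemeasurable, ← ofReal_integral_eq_lintegral_ofReal hint
      (Filter.Eventually.of_forall hf0)] at hs
    exact (ENNReal.ofReal_le_ofReal_iff hint0).1 hs
  split_ifs with hcrit
  · set A : ℝ := 4 ^ (-α) with hA
    set B : ℝ := (2 * ε ^ 2) ^ (-α) with hB
    have hA0 : 0 < A := by positivity
    have hB0 : 0 < B := by positivity
    have hAB : A ≤ B := by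
      apply Real.rpow_le_rpow_of_nonpos (by positivity) (by nlinarith) (by linarith)
    have key : ∀ t ∈ Set.Ioc A B, ENNReal.ofReal (C * 2 ^ (-α) * t⁻¹) ≤
        σ {θ | t < (S θ + ε ^ 2) ^ (-α)} := by
      intro t ht
      have ht0 : 0 < t := hA0.trans ht.1
      set u : ℝ := t ^ (-α⁻¹) with hu
      have hu0 : 0 < u := by positivity
      have hut : u ^ (-α) = t := by
        rw [hu, ← Real.rpow_mul ht0.le]
        have : -α⁻¹ * -α = 1 := by field_simp
        rw [this, Real.rpow_one]
      have inv : ∀ y : ℝ, 0 < y → (y ^ (-α)) ^ (-α⁻¹) = y := by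
        intro y hy
        rw [← Real.rpow_mul hy.le]
        have : -α * -α⁻¹ = 1 := by field_simp
        rw [this, Real.rpow_one]
      have hneg : -α⁻¹ ≤ 0 := by have := inv_pos.2 hα; linarith
      have hu4 : u ≤ 4 := by
        rw [← inv 4 (by norm_num)]
        exact Real.rpow_le_rpow_of_nonpos hA0 ht.1.le hneg
      have hu2 : 2 * ε ^ 2 ≤ u := by
        rw [← inv (2 * ε ^ 2) (by positivity)]
        exact Real.rpow_le_rpow_of_nonpos ht0 ht.2 hneg
      have hd := hcap (Real.sqrt (u / 2)) (by positivity)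
        (by rw [Real.sqrt_le_left (by norm_num)]; linarith)
      have hpow : Real.sqrt (u / 2) ^ k = 2 ^ (-α) * t⁻¹ := by
        rw [Real.sqrt_eq_rpow, ← Real.rpow_natCast, ← Real.rpow_mul (by positivity), ← hcrit]
        have : 1 / 2 * (2 * α) = α := by ring
        rw [this, Real.div_rpow hu0.le (by norm_num), ← hut, Real.rpow_neg hu0.le,
          Real.rpow_neg (by norm_num), inv_inv]
        ring
      rw [hpow, ← mul_assoc] at hd
      refine hd.trans (measure_mono ?_)
      intro θ hθ
      simp only [Set.mem_ofPred_eq] at hθ ⊢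
      rw [Real.sq_sqrt (by positivity)] at hθ
      have hlt : S θ + ε ^ 2 < u := by
        have : S θ < u / 2 := hθ
        linarith
      calc t = u ^ (-α) := hut.symm
        _ < _ := Real.rpow_lt_rpow_of_neg (hpos θ) hlt (by linarith)
    have hii : IntegrableOn (fun t : ℝ => C * 2 ^ (-α) * t⁻¹) (Set.Ioc A B) := by
      rw [← intervalIntegrable_iff_integrableOn_Ioc_of_le hAB]
      apply ContinuousOn.intervalIntegrable
      rw [Set.uIcc_of_le hAB]
      exact continuousOn_const.mul (continuousOn_id.inv₀ fun t ht => (hA0.trans_le ht.1).ne')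
    have hval : ∫ t in Set.Ioc A B, C * 2 ^ (-α) * t⁻¹ = C * 2 ^ (-α) * Real.log (B / A) := by
      rw [← intervalIntegral.integral_of_le hAB, intervalIntegral.integral_const_mul,
        integral_inv_of_pos hA0 hB0]
    have hlog : min 1 (2 * α) * Real.log (1 / ε) ≤ Real.log (B / A) := by
      rw [Real.log_div hB0.ne' hA0.ne', hA, hB, Real.log_rpow (by positivity),
        Real.log_rpow (by norm_num), Real.log_mul (by norm_num) (by positivity), Real.log_pow,
        one_div, Real.log_inv]
      have h1 : Real.log 2 ≤ Real.log 4 := Real.log_le_log (by norm_num) (by norm_num)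
      have h2 : Real.log ε < 0 := Real.log_neg hε hε1
      have h3 := mul_le_mul_of_nonneg_right (min_le_right 1 (2 * α)) (by linarith : 0 ≤ -Real.log ε)
      push_cast
      nlinarith
    calc _ ≤ ENNReal.ofReal (∫ t in Set.Ioc A B, C * 2 ^ (-α) * t⁻¹) := by
          rw [hval, mul_assoc (C * 2 ^ (-α))]
          gcongr
      _ = ∫⁻ t in Set.Ioc A B, ENNReal.ofReal (C * 2 ^ (-α) * t⁻¹) := by
          apply ofReal_integral_eq_lintegral_ofReal hii
          filter_upwards [ae_restrict_mem measurableSet_Ioc] with t ht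
          have : 0 < t := hA0.trans ht.1
          simp only [Pi.zero_apply]
          positivity
      _ ≤ ∫⁻ t in Set.Ioc A B, σ {θ | t < (S θ + ε ^ 2) ^ (-α)} :=
          setLIntegral_mono' measurableSet_Ioc key
      _ ≤ _ := lintegral_mono_set fun t ht => hA0.trans ht.1
  · set B : ℝ := (2 * ε ^ 2) ^ (-α) with hB
    have hB0 : 0 < B := by positivity
    have key : ∀ t ∈ Set.Ioc 0 B, ENNReal.ofReal (C * ε ^ k) ≤
        σ {θ | t < (S θ + ε ^ 2) ^ (-α)} := by
      intro t ht
      refine (hcap ε hε (by linarith)).trans (measure_mono ?_)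
      intro θ hθ
      simp only [Set.mem_ofPred_eq] at hθ ⊢
      have hlt : S θ + ε ^ 2 < 2 * ε ^ 2 := by
        have : S θ < ε ^ 2 := hθ
        linarith
      exact ht.2.trans_lt (Real.rpow_lt_rpow_of_neg (hpos θ) hlt (by linarith))
    calc _ ≤ ENNReal.ofReal (C * ε ^ k) * volume (Set.Ioc 0 B) := by
          rw [Real.volume_Ioc, sub_zero, ← ENNReal.ofReal_mul (by positivity)]
          apply ENNReal.ofReal_le_ofReal
          have e : C * ε ^ k * B = C * 2 ^ (-α) * 1 * (1 / ε) ^ (2 * α - k) := by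
            have e1 : (1 / ε) ^ (2 * α - k) = ε ^ k * (ε ^ 2) ^ (-α) := by
              rw [one_div, Real.inv_rpow hε.le, ← Real.rpow_neg hε.le, ← Real.rpow_natCast ε k,
                ← Real.rpow_natCast ε 2, ← Real.rpow_mul hε.le, ← Real.rpow_add hε]
              congr 1; push_cast; ring
            rw [e1, hB, Real.mul_rpow (by norm_num) (by positivity)]
            ring
          rw [e]
          gcongr
          exact min_le_left _ _
      _ = ∫⁻ t in Set.Ioc 0 B, ENNReal.ofReal (C * ε ^ k) := by
          rw [setLIntegral_const]
      _ ≤ ∫⁻ t in Set.Ioc 0 B, σ {θ | t < (S θ + ε ^ 2) ^ (-α)} :=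
          setLIntegral_mono' measurableSet_Ioc key
      _ ≤ _ := lintegral_mono_set fun t ht => ht.1
end

section
/- Let q : ℝ^k → ℂ be as in the standing assumptions, and let u be a tempered distribution on ℝ^k which extends 1/q and is homogeneous of degree −α. Let ψ be a Schwartz function on ℝ^k with ∫_{ℝ^k} ψ = 1, and for t > 0 set ψ_t(η) = t^k ψ(tη) and g_t(η) = ⟨u, ψ_t(η − ·)⟩. Then sup_{η ∈ ℝ^k} |g_t(η)| → 0 as t → 0⁺; that is, for every ε > 0 there exists δ > 0 such that |g_t(η)| ≤ ε for all 0 < t < δ and all η ∈ ℝ^k. -/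
open MeasureTheory

/-- Product bound for Schwartz seminorms. -/
lemma aux_seminorm_mul {E : Type*} [NormedAddCommGroup E] [NormedSpace ℝ E]
    (c f h : SchwartzMap E ℂ) (hh : ∀ x, h x = c x * f x) (B : ℕ → ℝ)
    (hB : ∀ n x, ‖iteratedFDeriv ℝ n f x‖ ≤ B n) (m n : ℕ) :
    SchwartzMap.seminorm ℂ m n h ≤ ∑ i ∈ Finset.range (n + 1),
      (n.choose i : ℝ) * SchwartzMap.seminorm ℂ m i c * B (n - i) := by
  have hB0 : ∀ n, 0 ≤ B n := fun n => (norm_nonneg _).trans (hB n 0)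
  refine SchwartzMap.seminorm_le_bound ℂ m n h ?_ ?_
  · refine Finset.sum_nonneg fun i _ => ?_
    have := hB0 (n - i)
    have h2 : 0 ≤ SchwartzMap.seminorm ℂ m i c := apply_nonneg _ _
    positivity
  · intro x
    have e : (h : E → ℂ) = fun y => c y * f y := funext hh
    rw [e]
    have := norm_iteratedFDeriv_mul_le (𝕜 := ℝ) (N := n) (c.smooth n) (f.smooth n) x (n := n) le_rfl
    calc _ ≤ ‖x‖ ^ m * _ := mul_le_mul_of_nonneg_left this (by positivity)
      _ ≤ _ := by
        rw [Finset.mul_sum]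
        refine Finset.sum_le_sum fun i _ => ?_
        have h1 := SchwartzMap.le_seminorm ℂ m i c x
        have h2 := hB (n - i) x
        have h3 := mul_le_mul h1 h2 (norm_nonneg _) ((by positivity : (0:ℝ) ≤ _).trans h1)
        calc _ = (n.choose i : ℝ) * (‖x‖ ^ m * ‖iteratedFDeriv ℝ i c x‖ *
              ‖iteratedFDeriv ℝ (n - i) f x‖) := by ring
          _ ≤ (n.choose i : ℝ) * (SchwartzMap.seminorm ℂ m i c * B (n - i)) :=
            mul_le_mul_of_nonneg_left h3 (by positivity)
          _ = _ := by ring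

/-- Reflection and translation do not change sup bounds of derivatives. -/
lemma aux_reflect {E : Type*} [NormedAddCommGroup E] [NormedSpace ℝ E]
    (ψ f : SchwartzMap E ℂ) (ξ : E) (hf : ∀ x, f x = ψ (ξ - x)) (n : ℕ) (x : E) :
    ‖iteratedFDeriv ℝ n f x‖ ≤ SchwartzMap.seminorm ℂ 0 n ψ := by
  have e : (f : E → ℂ) = (fun y => ψ (ξ + y)) ∘ (LinearIsometryEquiv.neg ℝ (E := E)) := by
    funext y; simp [hf, sub_eq_add_neg]
  rw [e, LinearIsometryEquiv.norm_iteratedFDeriv_comp_right, iteratedFDeriv_comp_add_left]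
  exact SchwartzMap.norm_iteratedFDeriv_le_seminorm ℂ ψ n _

/-- The convolution of `u` with a Schwartz function is bounded. -/
lemma aux_bounded (k : ℕ) (α : ℝ) (hα : 0 < α)
    (q : EuclideanSpace ℝ (Fin k) → ℂ) (hq_cont : Continuous q)
    (hq_ell : ∀ η, q η = 0 → η = 0)
    (hq_hom : ∀ lam : ℝ, 0 < lam → ∀ η : EuclideanSpace ℝ (Fin k), η ≠ 0 →
      q (lam • η) = ((lam ^ α : ℝ) : ℂ) * q η)
    (u : SchwartzMap (EuclideanSpace ℝ (Fin k)) ℂ →L[ℂ] ℂ)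
    (hu_ext : ∀ φ : SchwartzMap (EuclideanSpace ℝ (Fin k)) ℂ,
      tsupport (⇑φ) ⊆ {η | η ≠ 0} → u φ = ∫ η, φ η / q η)
    (ψ : SchwartzMap (EuclideanSpace ℝ (Fin k)) ℂ) :
    ∃ M : ℝ, 0 < M ∧ ∀ (f : SchwartzMap (EuclideanSpace ℝ (Fin k)) ℂ)
      (ξ : EuclideanSpace ℝ (Fin k)), (∀ x, f x = ψ (ξ - x)) → ‖u f‖ ≤ M := by
  -- lower bound of q
  obtain ⟨c, hc0, hc⟩ : ∃ c : ℝ, 0 < c ∧ ∀ η, 1 ≤ ‖η‖ → c ≤ ‖q η‖ := by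
    obtain ⟨c, hc0, hc⟩ := (isCompact_sphere (0 : EuclideanSpace ℝ (Fin k)) 1).exists_forall_le'
      (f := fun η => ‖q η‖) hq_cont.norm.continuousOn (a := 0) (by
        intro b hb
        have hb1 : ‖b‖ = 1 := by simpa using hb
        refine norm_pos_iff.2 fun h => ?_
        rw [hq_ell b h] at hb1
        simp at hb1)
    refine ⟨c, hc0, fun η hη => ?_⟩
    have hpos : 0 < ‖η‖ := by linarith
    have hne : η ≠ 0 := norm_pos_iff.1 hpos
    have h1 := hc (‖η‖⁻¹ • η) (by simp [norm_smul, hpos.ne'])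
    have h2 := hq_hom ‖η‖ hpos (‖η‖⁻¹ • η) (by simp [hne])
    rw [smul_inv_smul₀ hpos.ne'] at h2
    rw [h2, norm_mul, Complex.norm_real, Real.norm_of_nonneg (by positivity)]
    have h3 : 1 ≤ ‖η‖ ^ α := Real.one_le_rpow hη hα.le
    nlinarith
  -- cutoff
  let b : ContDiffBump (0 : EuclideanSpace ℝ (Fin k)) := ⟨1, 2, one_pos, one_lt_two⟩
  have hbs : ContDiff ℝ ((⊤ : ℕ∞) : WithTop ℕ∞) (fun x => ((b x : ℝ) : ℂ)) :=
    Complex.ofRealCLM.contDiff.comp b.contDiff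
  have hbc : HasCompactSupport (fun x => ((b x : ℝ) : ℂ)) :=
    b.hasCompactSupport.comp_left (g := fun r : ℝ => (r : ℂ)) Complex.ofReal_zero
  let χ : SchwartzMap (EuclideanSpace ℝ (Fin k)) ℂ := hbc.toSchwartzMap hbs
  have hχ : ∀ x, χ x = ((b x : ℝ) : ℂ) := fun x => rfl
  -- seminorm bound for u
  obtain ⟨s, C, -, hC⟩ := Seminorm.bound_of_continuous
    (schwartz_withSeminorms ℂ (EuclideanSpace ℝ (Fin k)) ℂ)
    ((normSeminorm ℂ ℂ).comp u.toLinearMap) (by exact u.continuous.norm)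
  let B : ℕ × ℕ → ℝ := fun p => ∑ i ∈ Finset.range (p.2 + 1),
      (p.2.choose i : ℝ) * SchwartzMap.seminorm ℂ p.1 i χ * SchwartzMap.seminorm ℂ 0 (p.2 - i) ψ
  have hB0 : ∀ p, 0 ≤ B p := by
    intro p
    refine Finset.sum_nonneg fun i _ => ?_
    have h1 : 0 ≤ SchwartzMap.seminorm ℂ p.1 i χ := apply_nonneg _ _
    have h2 : 0 ≤ SchwartzMap.seminorm ℂ 0 (p.2 - i) ψ := apply_nonneg _ _
    positivity
  have hint0 : 0 ≤ ∫ x, ‖ψ x‖ := integral_nonneg fun _ => norm_nonneg _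
  have hS0 : 0 ≤ ∑ p ∈ s, B p := Finset.sum_nonneg fun p _ => hB0 p
  refine ⟨(C : ℝ) * (∑ p ∈ s, B p) + c⁻¹ * (∫ x, ‖ψ x‖) + 1, by positivity, ?_⟩
  intro f ξ hf
  let f1 : SchwartzMap (EuclideanSpace ℝ (Fin k)) ℂ := SchwartzMap.smulLeftCLM ℂ χ f
  have hf1 : ∀ x, f1 x = χ x * f x := fun x =>
    SchwartzMap.smulLeftCLM_apply_apply χ.hasTemperateGrowth f x
  have hsplit : u f = u f1 + u (f - f1) := by rw [← map_add]; congr 1; abel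
  have hu1 : ‖u f1‖ ≤ (C : ℝ) * (∑ p ∈ s, B p) := by
    have h1 : ‖u f1‖ ≤ (C : ℝ) * (s.sup (schwartzSeminormFamily ℂ _ ℂ)) f1 := hC f1
    refine h1.trans (mul_le_mul_of_nonneg_left ?_ C.2)
    refine Seminorm.finset_sup_apply_le hS0 fun p hp => ?_
    refine le_trans ?_ (Finset.single_le_sum (fun p _ => hB0 p) hp)
    exact aux_seminorm_mul χ f f1 hf1 (fun n => SchwartzMap.seminorm ℂ 0 n ψ)
      (aux_reflect ψ f ξ hf) p.1 p.2
  have hval : ∀ x, (f - f1) x = ((1 - b x : ℝ) : ℂ) * f x := by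
    intro x
    rw [SchwartzMap.sub_apply, hf1, hχ]; push_cast; ring
  have hzero : ∀ x, ‖x‖ < 1 → (f - f1) x = 0 := by
    intro x hx
    have : b x = 1 := b.one_of_mem_closedBall (by
      rw [mem_closedBall_zero_iff]; exact hx.le)
    rw [hval, this]; simp
  have hu2 : ‖u (f - f1)‖ ≤ c⁻¹ * (∫ x, ‖ψ x‖) := by
    rw [hu_ext (f - f1) (by
      intro x hx hx0
      subst hx0
      refine notMem_tsupport_iff_eventuallyEq.2 ?_ hx
      filter_upwards [Metric.ball_mem_nhds (0 : EuclideanSpace ℝ (Fin k)) one_pos] with y hy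
      exact hzero y (by simpa using hy))]
    have hI : (∫ x, c⁻¹ * ‖f x‖) = c⁻¹ * ∫ x, ‖ψ x‖ := by
      rw [integral_const_mul]
      simp_rw [hf]
      rw [integral_sub_left_eq_self (fun x => ‖ψ x‖) volume ξ]
    rw [← hI]
    refine norm_integral_le_of_norm_le (f.integrable.norm.const_mul _) (.of_forall fun x => ?_)
    rcases lt_or_ge ‖x‖ 1 with hx | hx
    · rw [hzero x hx]; simp; positivity
    · rw [norm_div, hval, norm_mul, Complex.norm_real, div_eq_inv_mul]
      have h0 : 0 ≤ b x := b.nonneg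
      have h1 : b x ≤ 1 := b.le_one
      rw [Real.norm_of_nonneg (by linarith)]
      refine mul_le_mul (inv_anti₀ hc0 (hc x hx)) ?_ ?_ (by positivity)
      · exact mul_le_of_le_one_left (norm_nonneg _) (by linarith)
      · exact mul_nonneg (by linarith) (norm_nonneg _)
  rw [hsplit]
  refine (norm_add_le _ _).trans ?_
  linarith

/-- if `u` is a tempered distribution extending `1/q`, homogeneous of degree
`-α`, `ψ` is Schwartz with `∫ ψ = 1`, and `g_t(η) = ⟨u, ψ_t(η - ·)⟩` with
`ψ_t(η) = t^k ψ(tη)`, then `sup_η |g_t(η)| → 0` as `t → 0⁺`. -/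
theorem statement17 (k : ℕ) (hk : 1 ≤ k) (α : ℝ) (hα : 0 < α)
    (q : EuclideanSpace ℝ (Fin k) → ℂ) (hq_cont : Continuous q)
    (hq_ell : ∀ η, q η = 0 → η = 0)
    (hq_hom : ∀ lam : ℝ, 0 < lam → ∀ η : EuclideanSpace ℝ (Fin k), η ≠ 0 →
      q (lam • η) = ((lam ^ α : ℝ) : ℂ) * q η)
    (u : SchwartzMap (EuclideanSpace ℝ (Fin k)) ℂ →L[ℂ] ℂ)
    (hu_ext : ∀ φ : SchwartzMap (EuclideanSpace ℝ (Fin k)) ℂ,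
      tsupport (⇑φ) ⊆ {η | η ≠ 0} → u φ = ∫ η, φ η / q η)
    (hu_hom : ∀ (φ χ : SchwartzMap (EuclideanSpace ℝ (Fin k)) ℂ) (lam : ℝ), 0 < lam →
      (∀ η, χ η = (lam : ℂ) ^ k * φ (lam • η)) →
      u φ = ((lam ^ (-α) : ℝ) : ℂ) * u χ)
    (ψ : SchwartzMap (EuclideanSpace ℝ (Fin k)) ℂ)
    (hψ : (∫ η, ψ η) = 1)
    (Ψ : ℝ → EuclideanSpace ℝ (Fin k) → SchwartzMap (EuclideanSpace ℝ (Fin k)) ℂ)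
    (hΨ : ∀ (t : ℝ) (η ζ : EuclideanSpace ℝ (Fin k)),
      Ψ t η ζ = (t : ℂ) ^ k * ψ (t • (η - ζ)))
    (g : ℝ → EuclideanSpace ℝ (Fin k) → ℂ)
    (hg : ∀ (t : ℝ) (η : EuclideanSpace ℝ (Fin k)), g t η = u (Ψ t η)) :
    ∀ ε : ℝ, 0 < ε → ∃ δ : ℝ, 0 < δ ∧
      ∀ t : ℝ, 0 < t → t < δ → ∀ η : EuclideanSpace ℝ (Fin k), ‖g t η‖ ≤ ε := by
  obtain ⟨M, hM, hb⟩ := aux_bounded k α hα q hq_cont hq_ell hq_hom u hu_ext ψ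
  intro ε hε
  refine ⟨(ε / M) ^ α⁻¹, by positivity, fun t ht htδ η => ?_⟩
  have h1 := hu_hom (Ψ 1 (t • η)) (Ψ t η) t ht (by
    intro ζ; rw [hΨ, hΨ]; simp [smul_sub])
  have h2 := hb (Ψ 1 (t • η)) (t • η) (by intro x; rw [hΨ]; simp)
  have h3 : ‖u (Ψ t η)‖ = t ^ α * ‖u (Ψ 1 (t • η))‖ := by
    rw [h1, norm_mul, Complex.norm_real, Real.norm_of_nonneg (by positivity), ← mul_assoc,
      ← Real.rpow_add ht]
    simp
  have h4 : t ^ α ≤ ε / M := by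
    have := Real.rpow_le_rpow ht.le htδ.le hα.le
    rwa [← Real.rpow_mul (by positivity), inv_mul_cancel₀ hα.ne', Real.rpow_one] at this
  rw [hg, h3]
  calc t ^ α * ‖u (Ψ 1 (t • η))‖ ≤ ε / M * M := by gcongr
    _ = ε := by field_simp
end

section
/- Let q : ℝ^k → ℂ be as in the standing assumptions, and let u be a tempered distribution on ℝ^k which extends 1/q and is homogeneous of degree −α. Let ψ be a Schwartz function on ℝ^k with ∫_{ℝ^k} ψ = 1, and for t > 0 set ψ_t(η) = t^k ψ(tη) and g_t(η) = ⟨u, ψ_t(η − ·)⟩. Then for every compact set K ⊂ ℝ^k with 0 ∉ K, sup_{η ∈ K} |1/q(η) − g_t(η)| → 0 as t → ∞. -/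
open MeasureTheory

open Filter Topology

/-- derivative bound for the rescaled bump. -/
theorem aux_deriv {k : ℕ} (ψ Φ : SchwartzMap (EuclideanSpace ℝ (Fin k)) ℂ)
    (t : ℝ) (ht : 0 < t) (η : EuclideanSpace ℝ (Fin k))
    (hΦ : ∀ ζ, Φ ζ = (t : ℂ) ^ k * ψ (t • (η - ζ))) (j : ℕ) (x : EuclideanSpace ℝ (Fin k)) :
    ‖iteratedFDeriv ℝ j Φ x‖ ≤ t ^ (k + j) * ‖iteratedFDeriv ℝ j ψ (t • (η - x))‖ := by
  set L : EuclideanSpace ℝ (Fin k) →L[ℝ] EuclideanSpace ℝ (Fin k) :=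
    (-t) • ContinuousLinearMap.id ℝ _ with hL
  have hLn : ‖L‖ ≤ t := by
    rw [hL, norm_smul, norm_neg, Real.norm_of_nonneg ht.le]
    exact mul_le_of_le_one_right ht.le ContinuousLinearMap.norm_id_le
  set f : EuclideanSpace ℝ (Fin k) → ℂ := fun y => ψ (t • η + y) with hf
  have hfs : ContDiff ℝ j f := (ψ.smooth j).comp (by fun_prop)
  have e : (Φ : EuclideanSpace ℝ (Fin k) → ℂ) = ((t : ℂ) ^ k) • (f ∘ L) := by
    ext ζ
    simp only [hΦ, Pi.smul_apply, Function.comp, hf, smul_eq_mul, hL]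
    congr 2
    simp [smul_sub, sub_eq_add_neg]
  have hc : ContDiff ℝ j (f ∘ L) := hfs.comp L.contDiff
  rw [e, iteratedFDeriv_const_smul_apply hc.contDiffAt, norm_smul,
    L.iteratedFDeriv_comp_right hfs x le_rfl]
  have e2 : iteratedFDeriv ℝ j f (L x) = iteratedFDeriv ℝ j ψ (t • (η - x)) := by
    rw [hf, iteratedFDeriv_comp_add_left]
    congr 1
    simp [hL, smul_sub, sub_eq_add_neg]
  rw [e2]
  have h1 := ContinuousMultilinearMap.norm_compContinuousLinearMap_le
    (iteratedFDeriv ℝ j ψ (t • (η - x))) (fun _ : Fin j => L)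
  have h2 : ‖(t : ℂ) ^ k‖ = t ^ k := by
    rw [norm_pow, Complex.norm_real, Real.norm_of_nonneg ht.le]
  rw [h2]
  calc _ ≤ t ^ k * (‖iteratedFDeriv ℝ j ψ (t • (η - x))‖ * t ^ j) := by
        gcongr
        refine h1.trans ?_
        simp only [Finset.prod_const, Finset.card_fin]
        gcongr
    _ = _ := by ring

theorem aux_far {k : ℕ} (ψ Φ : SchwartzMap (EuclideanSpace ℝ (Fin k)) ℂ)
    (t : ℝ) (ht : 0 < t) (η : EuclideanSpace ℝ (Fin k))
    (hΦ : ∀ ζ, Φ ζ = (t : ℂ) ^ k * ψ (t • (η - ζ))) (j : ℕ) (x : EuclideanSpace ℝ (Fin k))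
    (r : ℝ) (hr : 0 < r) (hx : r ≤ ‖η - x‖) :
    ‖iteratedFDeriv ℝ j Φ x‖ ≤
      (SchwartzMap.seminorm ℝ (k + j + 1) j ψ / r ^ (k + j + 1)) * t⁻¹ := by
  refine (aux_deriv ψ Φ t ht η hΦ j x).trans ?_
  have h := SchwartzMap.le_seminorm ℝ (k + j + 1) j ψ (t • (η - x))
  set A := ‖iteratedFDeriv ℝ j ψ (t • (η - x))‖
  have hA : 0 ≤ A := norm_nonneg _
  have h3 : (t * r) ^ (k + j + 1) * A ≤ SchwartzMap.seminorm ℝ (k + j + 1) j ψ := by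
    refine le_trans ?_ h
    rw [norm_smul, Real.norm_of_nonneg ht.le]
    gcongr
  rw [div_mul_eq_mul_div, le_div_iff₀ (by positivity), le_mul_inv_iff₀ ht]
  refine le_trans (le_of_eq ?_) h3
  ring

theorem aux_seminorm {k : ℕ} (ψ Θ : SchwartzMap (EuclideanSpace ℝ (Fin k)) ℂ)
    (r : ℝ) (hr : 0 < r) (hΘ : tsupport Θ ⊆ Metric.closedBall 0 r) (m n : ℕ) :
    ∃ C : ℝ, 0 ≤ C ∧ ∀ (t : ℝ), 0 < t → ∀ η : EuclideanSpace ℝ (Fin k), 2 * r ≤ ‖η‖ →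
      ∀ Φ Q : SchwartzMap (EuclideanSpace ℝ (Fin k)) ℂ,
      (∀ ζ, Φ ζ = (t : ℂ) ^ k * ψ (t • (η - ζ))) → (∀ ζ, Q ζ = Θ ζ * Φ ζ) →
      SchwartzMap.seminorm ℂ m n Q ≤ C * t⁻¹ := by
  refine ⟨r ^ m * ∑ i ∈ Finset.range (n + 1), (n.choose i : ℝ) * SchwartzMap.seminorm ℝ 0 i Θ *
    (SchwartzMap.seminorm ℝ (k + (n - i) + 1) (n - i) ψ / r ^ (k + (n - i) + 1)), ?_, ?_⟩
  · positivity
  intro t ht η hη Φ Q hΦ hQ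
  have hQ' : (Q : EuclideanSpace ℝ (Fin k) → ℂ) = fun y => Θ y * Φ y := funext hQ
  refine SchwartzMap.seminorm_le_bound ℂ m n Q (by positivity) ?_
  intro x
  by_cases hx : ‖x‖ ≤ r
  · rw [mul_assoc, Finset.sum_mul]
    gcongr
    rw [hQ']
    refine (norm_iteratedFDeriv_mul_le (Θ.smooth n) (Φ.smooth n) x le_rfl).trans ?_
    refine Finset.sum_le_sum fun i hi => ?_
    rw [mul_assoc (_ * _)]
    gcongr
    · simpa using SchwartzMap.le_seminorm ℝ 0 i Θ x
    · refine aux_far ψ Φ t ht η hΦ _ x r hr ?_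
      have := norm_sub_norm_le η x
      linarith
  · have : iteratedFDeriv ℝ n Q x = 0 := by
      by_contra hne
      have h1 := support_iteratedFDeriv_subset (𝕜 := ℝ) (f := (Q : EuclideanSpace ℝ (Fin k) → ℂ)) n hne
      rw [hQ'] at h1
      have h2 := hΘ (tsupport_mul_subset_left h1)
      simp at h2
      exact hx h2
    rw [this]
    simp
    positivity

theorem aux_near {k : ℕ} (ψ Θ : SchwartzMap (EuclideanSpace ℝ (Fin k)) ℂ)
    (u : SchwartzMap (EuclideanSpace ℝ (Fin k)) ℂ →L[ℂ] ℂ)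
    (r : ℝ) (hr : 0 < r) (hΘ : tsupport Θ ⊆ Metric.closedBall 0 r) :
    ∃ C : ℝ, ∀ (t : ℝ), 0 < t → ∀ η : EuclideanSpace ℝ (Fin k), 2 * r ≤ ‖η‖ →
      ∀ Φ Q : SchwartzMap (EuclideanSpace ℝ (Fin k)) ℂ,
      (∀ ζ, Φ ζ = (t : ℂ) ^ k * ψ (t • (η - ζ))) → (∀ ζ, Q ζ = Θ ζ * Φ ζ) →
      ‖u Q‖ ≤ C * t⁻¹ := by
  obtain ⟨s, C, hC, hb⟩ := Seminorm.bound_of_continuous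
    (schwartz_withSeminorms ℂ (EuclideanSpace ℝ (Fin k)) ℂ)
    ((normSeminorm ℂ ℂ).comp u.toLinearMap) (u.continuous.norm)
  choose D hD0 hD using aux_seminorm ψ Θ r hr hΘ
  refine ⟨C * ∑ i ∈ s, D i.1 i.2, ?_⟩
  intro t ht η hη Φ Q hΦ hQ
  have h1 := hb Q
  simp only [Seminorm.comp_apply, smul_apply] at h1
  refine h1.trans ?_
  rw [mul_assoc, NNReal.smul_def, smul_eq_mul]
  gcongr
  have hs : 0 ≤ ∑ i ∈ s, D i.1 i.2 := Finset.sum_nonneg fun i _ => hD0 _ _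
  refine Seminorm.finset_sup_apply_le (by positivity) fun i hi => ?_
  refine (hD i.1 i.2 t ht η hη Φ Q hΦ hQ).trans ?_
  gcongr
  exact Finset.single_le_sum (f := fun i : ℕ × ℕ => D i.1 i.2) (fun i _ => hD0 _ _) hi

/-- approximate identity. -/
theorem aux_approx {k : ℕ} (ψ : SchwartzMap (EuclideanSpace ℝ (Fin k)) ℂ) (hψ : (∫ η, ψ η) = 1)
    (F : EuclideanSpace ℝ (Fin k) → ℂ) (hF : Continuous F) (B : ℝ) (hB : ∀ x, ‖F x‖ ≤ B)
    (K : Set (EuclideanSpace ℝ (Fin k))) (hK : IsCompact K) (ε : ℝ) (hε : 0 < ε) :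
    ∀ᶠ t : ℝ in atTop, ∀ η ∈ K, ‖F η - ∫ ζ, F ζ * ((t : ℂ) ^ k * ψ (t • (η - ζ)))‖ < ε := by
  have hcont : Continuous fun p : ℝ × EuclideanSpace ℝ (Fin k) =>
      ∫ z, F (p.2 - p.1 • z) * ψ z := by
    refine continuous_of_dominated (bound := fun z => B * ‖ψ z‖) ?_ ?_ ?_ ?_
    · intro p
      exact (Continuous.mul (by fun_prop) ψ.continuous).aestronglyMeasurable
    · intro p
      refine Eventually.of_forall fun z => ?_
      rw [norm_mul]
      gcongr
      exact hB _
    · exact ψ.integrable.norm.const_mul B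
    · refine Eventually.of_forall fun z => ?_
      fun_prop
  have h0 : ∀ᶠ s : ℝ in 𝓝 0, ∀ η ∈ K, ‖F η - ∫ z, F (η - s • z) * ψ z‖ < ε := by
    refine hK.eventually_forall_of_forall_eventually fun η _ => ?_
    have hc2 : Continuous fun p : ℝ × EuclideanSpace ℝ (Fin k) =>
        ‖F p.2 - ∫ z, F (p.2 - p.1 • z) * ψ z‖ := by fun_prop
    refine hc2.continuousAt.eventually_lt continuousAt_const ?_
    simp [integral_const_mul, hψ, hε]
  filter_upwards [tendsto_inv_atTop_zero.eventually h0, eventually_gt_atTop 0] with t ht htpos η hη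
  convert ht η hη using 3
  rw [← integral_sub_left_eq_self _ volume η]
  have h2 := Measure.integral_comp_smul (volume : Measure (EuclideanSpace ℝ (Fin k)))
    (fun z => F (η - t⁻¹ • z) * ψ z) t
  simp only [finrank_euclideanSpace, Fintype.card_fin, smul_smul,
    inv_mul_cancel₀ htpos.ne', one_smul] at h2
  have h3 : (∫ z, F (η - z) * ((t : ℂ) ^ k * ψ (t • (η - (η - z))))) =
     (t : ℂ) ^ k * ∫ z, F (η - z) * ψ (t • z) := by
    rw [← integral_const_mul]
    congr 1
    ext z
    rw [sub_sub_cancel]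
    ring
  rw [h3, h2, abs_of_pos (by positivity), Complex.real_smul]
  push_cast
  rw [mul_inv_cancel_left₀ (by exact_mod_cast (pow_pos htpos k).ne')]

theorem aux_lower {k : ℕ} (α : ℝ) (hα : 0 < α)
    (q : EuclideanSpace ℝ (Fin k) → ℂ) (hq_cont : Continuous q)
    (hq_ell : ∀ η, q η = 0 → η = 0)
    (hq_hom : ∀ lam : ℝ, 0 < lam → ∀ η : EuclideanSpace ℝ (Fin k), η ≠ 0 →
      q (lam • η) = ((lam ^ α : ℝ) : ℂ) * q η) (r : ℝ) (hr : 0 < r) :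
    ∃ B : ℝ, ∀ x, r ≤ ‖x‖ → ‖(q x)⁻¹‖ ≤ B := by
  obtain ⟨B, hB⟩ := (isCompact_sphere (0 : EuclideanSpace ℝ (Fin k)) r).exists_bound_of_continuousOn
    (f := fun x => (q x)⁻¹) (hq_cont.continuousOn.inv₀ fun x hx h => by
      have := hq_ell x h
      subst this
      simp at hx
      linarith)
  refine ⟨B, fun x hx => ?_⟩
  have hxp : 0 < ‖x‖ := hr.trans_le hx
  have hx0 : x ≠ 0 := norm_pos_iff.1 hxp
  set y := (r / ‖x‖) • x with hy
  have hyn : ‖y‖ = r := by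
    rw [hy, norm_smul, Real.norm_of_nonneg (by positivity)]
    field_simp
  have hy0 : y ≠ 0 := norm_pos_iff.1 (hyn ▸ hr)
  have hxy : x = (‖x‖ / r) • y := by
    rw [hy, smul_smul]
    field_simp
    simp
  have h1 := hB y (by simp [hyn])
  have h2 := hq_hom (‖x‖ / r) (by positivity) y hy0
  rw [← hxy] at h2
  have h3 : 1 ≤ (‖x‖ / r) ^ α := Real.one_le_rpow ((one_le_div hr).2 hx) hα.le
  rw [h2, mul_inv, norm_mul, norm_inv, Complex.norm_real, Real.norm_of_nonneg (by positivity)]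
  refine le_trans ?_ h1
  exact mul_le_of_le_one_left (norm_nonneg _) (inv_le_one_of_one_le₀ h3)

/-- if `u` is a tempered distribution extending `1/q`, homogeneous of degree
`-α`, `ψ` is Schwartz with `∫ ψ = 1`, and `g_t(η) = ⟨u, ψ_t(η - ·)⟩` with
`ψ_t(η) = t^k ψ(tη)`, then for every compact `K ⊆ ℝ^k` with `0 ∉ K`,
`sup_{η ∈ K} |1/q(η) - g_t(η)| → 0` as `t → ∞`. -/
theorem statement18 (k : ℕ) (hk : 1 ≤ k) (α : ℝ) (hα : 0 < α)
    (q : EuclideanSpace ℝ (Fin k) → ℂ) (hq_cont : Continuous q)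
    (hq_ell : ∀ η, q η = 0 → η = 0)
    (hq_hom : ∀ lam : ℝ, 0 < lam → ∀ η : EuclideanSpace ℝ (Fin k), η ≠ 0 →
      q (lam • η) = ((lam ^ α : ℝ) : ℂ) * q η)
    (u : SchwartzMap (EuclideanSpace ℝ (Fin k)) ℂ →L[ℂ] ℂ)
    (hu_ext : ∀ φ : SchwartzMap (EuclideanSpace ℝ (Fin k)) ℂ,
      tsupport (⇑φ) ⊆ {η | η ≠ 0} → u φ = ∫ η, φ η / q η)
    (hu_hom : ∀ (φ χ : SchwartzMap (EuclideanSpace ℝ (Fin k)) ℂ) (lam : ℝ), 0 < lam →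
      (∀ η, χ η = (lam : ℂ) ^ k * φ (lam • η)) →
      u φ = ((lam ^ (-α) : ℝ) : ℂ) * u χ)
    (ψ : SchwartzMap (EuclideanSpace ℝ (Fin k)) ℂ)
    (hψ : (∫ η, ψ η) = 1)
    (Ψ : ℝ → EuclideanSpace ℝ (Fin k) → SchwartzMap (EuclideanSpace ℝ (Fin k)) ℂ)
    (hΨ : ∀ (t : ℝ) (η ζ : EuclideanSpace ℝ (Fin k)),
      Ψ t η ζ = (t : ℂ) ^ k * ψ (t • (η - ζ)))
    (g : ℝ → EuclideanSpace ℝ (Fin k) → ℂ)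
    (hg : ∀ (t : ℝ) (η : EuclideanSpace ℝ (Fin k)), g t η = u (Ψ t η)) :
    ∀ K : Set (EuclideanSpace ℝ (Fin k)), IsCompact K → (0 : EuclideanSpace ℝ (Fin k)) ∉ K →
      ∀ ε : ℝ, 0 < ε → ∃ T : ℝ, ∀ t : ℝ, T ≤ t →
        ∀ η ∈ K, ‖1 / q η - g t η‖ ≤ ε := by
  intro K hK h0K ε hε
  -- a radius separating `K` from the origin
  obtain ⟨r, hr, hrK⟩ : ∃ r : ℝ, 0 < r ∧ ∀ η ∈ K, 2 * r ≤ ‖η‖ := by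
    obtain ⟨δ, hδ, hd⟩ := Metric.isOpen_iff.1 hK.isClosed.isOpen_compl 0 h0K
    refine ⟨δ / 2, by positivity, fun η hη => ?_⟩
    by_contra hlt
    exact hd (show η ∈ Metric.ball 0 δ by rw [mem_ball_zero_iff]; linarith) hη
  let b : ContDiffBump (0 : EuclideanSpace ℝ (Fin k)) := ⟨r / 2, r, by positivity, by linarith⟩
  have hcs : HasCompactSupport fun x => ((b x : ℝ) : ℂ) :=
    b.hasCompactSupport.comp_left (g := fun x : ℝ => (x : ℂ)) (by simp)
  have hsm : ContDiff ℝ ((⊤ : ℕ∞) : WithTop ℕ∞) fun x => ((b x : ℝ) : ℂ) :=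
    Complex.ofRealCLM.contDiff.comp b.contDiff
  let Θ : SchwartzMap (EuclideanSpace ℝ (Fin k)) ℂ := hcs.toSchwartzMap hsm
  have hΘ : ∀ x, Θ x = ((b x : ℝ) : ℂ) := fun x => rfl
  have hΘs : tsupport Θ ⊆ Metric.closedBall 0 r := by
    refine closure_minimal ?_ Metric.isClosed_closedBall
    intro x hx
    have h1 : x ∈ Function.support b := by
      intro h
      apply hx
      rw [hΘ, h]
      simp
    rw [b.support_eq] at h1
    exact Metric.ball_subset_closedBall h1
  have hΘone : ∀ x, ‖x‖ ≤ r / 2 → Θ x = 1 := by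
    intro x hx
    rw [hΘ, b.one_of_mem_closedBall (by simpa using hx)]
    simp
  have hΘzero : ∀ x, r ≤ ‖x‖ → Θ x = 0 := by
    intro x hx
    rw [hΘ, b.zero_of_le_dist (by simpa using hx)]
    simp
  have hone : ∀ x, ‖1 - Θ x‖ ≤ 1 := by
    intro x
    have h1 := b.nonneg (x := x)
    have h2 := b.le_one (x := x)
    rw [hΘ, ← Complex.ofReal_one, ← Complex.ofReal_sub, Complex.norm_real,
      Real.norm_of_nonneg (by linarith)]
    linarith
  -- the regularised symbol
  let F : EuclideanSpace ℝ (Fin k) → ℂ := fun x => (1 - Θ x) * (q x)⁻¹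
  have hev : ∀ᶠ x in 𝓝 (0 : EuclideanSpace ℝ (Fin k)), Θ x = 1 := by
    filter_upwards [Metric.closedBall_mem_nhds (0 : EuclideanSpace ℝ (Fin k))
      (show 0 < r / 2 by positivity)] with x hx
    exact hΘone x (by simpa using hx)
  have hFc : Continuous F := by
    rw [continuous_iff_continuousAt]
    intro x
    by_cases hx : x = 0
    · subst hx
      have h1 : F =ᶠ[𝓝 0] fun _ => (0 : ℂ) := by
        filter_upwards [hev] with y hy
        simp [F, hy]
      exact continuousAt_const.congr h1.symm
    · exact (continuousAt_const.sub Θ.continuous.continuousAt).mul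
        (hq_cont.continuousAt.inv₀ fun h => hx (hq_ell x h))
  obtain ⟨B, hB⟩ := aux_lower α hα q hq_cont hq_ell hq_hom (r / 2) (by positivity)
  have hFB : ∀ x, ‖F x‖ ≤ max B 0 := by
    intro x
    by_cases hx : ‖x‖ ≤ r / 2
    · simp [F, hΘone x hx]
    · have h1 := hB x (not_le.1 hx).le
      have h2 : ‖F x‖ ≤ 1 * ‖(q x)⁻¹‖ := by
        simp only [F, norm_mul]
        gcongr
        exact hone x
      exact le_max_of_le_left (by linarith)
  have hA := aux_approx ψ hψ F hFc _ hFB K hK (ε / 2) (by positivity)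
  obtain ⟨C, hC⟩ := aux_near ψ Θ u r hr hΘs
  have hCt : ∀ᶠ t : ℝ in atTop, C * t⁻¹ < ε / 2 := by
    have h1 : Tendsto (fun t : ℝ => C * t⁻¹) atTop (𝓝 (C * 0)) :=
      tendsto_inv_atTop_zero.const_mul C
    rw [mul_zero] at h1
    exact h1.eventually_lt_const (by positivity)
  obtain ⟨T, hT⟩ := eventually_atTop.1 ((hA.and hCt).and (eventually_gt_atTop 0))
  refine ⟨T, fun t htT η hη => ?_⟩
  obtain ⟨⟨h1, h2⟩, ht⟩ := hT t htT
  have hη1 := h1 η hη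
  set Q : SchwartzMap (EuclideanSpace ℝ (Fin k)) ℂ := SchwartzMap.smulLeftCLM ℂ Θ (Ψ t η) with hQdef
  have hQ : ∀ ζ, Q ζ = Θ ζ * Ψ t η ζ := fun ζ => by
    rw [hQdef, SchwartzMap.smulLeftCLM_apply_apply Θ.hasTemperateGrowth, smul_eq_mul]
  have hnear := hC t ht η (hrK η hη) (Ψ t η) Q (hΨ t η) hQ
  have hfar : u (Ψ t η - Q) = ∫ ζ, F ζ * ((t : ℂ) ^ k * ψ (t • (η - ζ))) := by
    rw [hu_ext]
    · congr 1
      ext ζ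
      rw [SchwartzMap.sub_apply, hQ, hΨ]
      simp only [F]
      ring
    · intro x hx hx0
      subst hx0
      revert hx
      rw [imp_false, notMem_tsupport_iff_eventuallyEq]
      filter_upwards [hev] with y hy
      simp [hQ, hy]
  have hFη : F η = 1 / q η := by
    simp [F, hΘzero η (by linarith [hrK η hη])]
  have hsplit : 1 / q η - g t η = (F η - u (Ψ t η - Q)) - u Q := by
    rw [hg, hFη, map_sub]
    ring
  rw [hsplit]
  rw [← hfar] at hη1
  refine (norm_sub_le _ _).trans ?_
  linarith
end
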